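/- A sequence (d_i)_{i≥1} over a finite alphabet A ⊆ ℕ is the (−β)-expansion of −β/(β+1) for some real β > 1 if and only if the following three conditions hold: (a) for all n ≥ 1, (d_i)_{i≥1} ⪯ (d_{n+i−1})_{i≥1} ≺ (d*_{i−1})_{i≥1} in the alternate order, where d*_0 = 0; (b) (d_i)_{i≥1} ∉ Lyn; (c) (d_i)_{i≥1} ≺ φ^∞(1). -/

import Mathlib

open Filter Topology

/-- Alternate (Ito–Sadahiro) strict order on infinite sequences (0-indexed: entry `i`
is the `(i+1)`-th letter `x_{i+1}` of the paper). `altLt x y` iff at the first index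
where they differ the comparison alternates with the parity of the index:
`(-1)^k (x_k - y_k) < 0` in 1-based indexing. -/
def altLt (x y : ℕ → ℕ) : Prop :=
  ∃ k : ℕ, (∀ i < k, x i = y i) ∧ (if Even k then y k < x k else x k < y k)

def altLe (x y : ℕ → ℕ) : Prop := x = y ∨ altLt x y

def shiftSeq (x : ℕ → ℕ) (k : ℕ) : ℕ → ℕ := fun i => x (k + i)

/-- An alternate Lyndon word: smaller (in the alternate order) than all of its shifts. -/
def IsAltLyndon (d : ℕ → ℕ) : Prop := ∀ k : ℕ, altLe d (shiftSeq d k)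

/-- The Lyndon system associated to `d`: sequences over the alphabet `{0, …, d_1}`
all of whose shifts dominate `d` in the alternate order. -/
def LyndonSystem (d : ℕ → ℕ) : Set (ℕ → ℕ) :=
  {x | (∀ i, x i ≤ d 0) ∧ ∀ k : ℕ, altLe d (shiftSeq x k)}

def IsFactorOf (w : List ℕ) (x : ℕ → ℕ) : Prop :=
  ∃ k : ℕ, w = (List.range w.length).map (fun i => x (k + i))

/-- The language of the Lyndon system: finite factors of its elements. -/
def LyndonLang (d : ℕ → ℕ) : Set (List ℕ) :=
  {w | ∃ x ∈ LyndonSystem d, IsFactorOf w x}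

/-- `Hword d n` is the number of words of length `n` in the language `L_M`. -/
noncomputable def Hword (d : ℕ → ℕ) (n : ℕ) : ℕ :=
  Set.ncard {w : List ℕ | w ∈ LyndonLang d ∧ w.length = n}

/-- The topological entropy of the Lyndon system of `d` equals `h`,
i.e. `lim_{n→∞} (log H_n)/n = h`. -/
def EntropyIs (d : ℕ → ℕ) (h : ℝ) : Prop :=
  Filter.Tendsto (fun n : ℕ => Real.log (Hword d n) / n) Filter.atTop (nhds h)

/-- The substitution `φ` on letters: `φ(0) = 1`, `φ(1) = 100`. -/
def phiL (a : ℕ) : List ℕ := if a = 0 then [1] else [1, 0, 0]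
/-- `φ` extended to words. -/
def phiW (w : List ℕ) : List ℕ := w.flatMap phiL
/-- `uW n = φ^n(1)`. -/
def uW (n : ℕ) : List ℕ := phiW^[n] [1]
/-- The infinite fixed point `φ^∞(1)` (each `uW n` is a prefix of `uW (n+1)`,
and `|uW (i+1)| > i`, so the definition below gives the limit word). -/
def phiInf : ℕ → ℕ := fun i => (uW (i + 1)).getD i 0

/-- The periodic infinite word `\overline{w}` associated to a finite word `w`. -/
def periodicSeq (w : List ℕ) : ℕ → ℕ := fun i => w.getD (i % w.length) 0
/-- The infinite word `p \overline{w}`: the finite word `p` followed by the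
periodic repetition of `w`. -/
def prefixPeriodic (p w : List ℕ) : ℕ → ℕ :=
  fun i => if i < p.length then p.getD i 0 else w.getD ((i - p.length) % w.length) 0

/-- From the word `a_1 ⋯ a_k` produce the word `a_1 ⋯ a_{k−1} (a_k − 1) 0`. -/
def modList (w : List ℕ) : List ℕ :=
  w.take (w.length - 1) ++ [w.getD (w.length - 1) 0 - 1, 0]

/-- The `(−β)`-transformation `T_{−β}(x) = −βx − ⌊−βx − l_β⌋` with `l_β = −β/(β+1)`. -/
noncomputable def negBetaT (β : ℝ) (x : ℝ) : ℝ :=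
  -β * x - ⌊-β * x + β / (β + 1)⌋

/-- `d` is periodic of minimal period `2p+1` (an odd period). -/
def MinOddPeriodAt (d : ℕ → ℕ) (p : ℕ) : Prop :=
  (∀ i, d (i + (2 * p + 1)) = d i) ∧
    ∀ m : ℕ, 1 ≤ m → m < 2 * p + 1 → ¬ ∀ i, d (i + m) = d i

/-- `(d*_i)`: if `d = \overline{(d_1,…,d_{2p+1})}` with minimal odd period `2p+1`,
then `d* = \overline{(d_1,…,d_{2p}, d_{2p+1}−1, 0)}`; otherwise `d* = d`. -/
noncomputable def dstarOf (d : ℕ → ℕ) : ℕ → ℕ := by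
  classical
  exact if h : ∃ p : ℕ, MinOddPeriodAt d p then
    periodicSeq ((List.range (2 * h.choose)).map d ++ [d (2 * h.choose) - 1, 0])
  else d

/-- The sequence `(d*_{i−1})_{i≥1} = 0 d*_1 d*_2 ⋯` with the convention `d*_0 = 0`. -/
noncomputable def dstarShift (d : ℕ → ℕ) : ℕ → ℕ :=
  fun i => if i = 0 then 0 else dstarOf d (i - 1)

/-- The set `Lyn`: alternate Lyndon words `d` for which there is a periodic
alternate Lyndon word `\overline{a_1⋯a_k}` (`k` minimal, `a_k ≠ 0`) with
`d ≠ \overline{a_1⋯a_k}` and `min_k ⪯ d ⪯ max_k ≺ φ^∞(1)`. -/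
def LynSet : Set (ℕ → ℕ) :=
  {d | IsAltLyndon d ∧ ∃ a : List ℕ, 1 ≤ a.length ∧ a.getD (a.length - 1) 0 ≠ 0 ∧
    IsAltLyndon (periodicSeq a) ∧
    (∀ m : ℕ, 1 ≤ m → m < a.length →
      ¬ ∀ i, periodicSeq a (i + m) = periodicSeq a i) ∧
    d ≠ periodicSeq a ∧
    (if Even a.length
      then altLe (prefixPeriodic (modList a) a) d ∧ altLe d (periodicSeq a) ∧
        altLt (periodicSeq a) phiInf
      else altLe (prefixPeriodic a (modList a)) d ∧ altLe d (periodicSeq (modList a)) ∧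
        altLt (periodicSeq (modList a)) phiInf)}



namespace NB

theorem altLt_irrefl (x : ℕ → ℕ) : ¬ altLt x x := by
  rintro ⟨k, _, h⟩
  split_ifs at h <;> omega

theorem altLt_trans {x y z : ℕ → ℕ} (h1 : altLt x y) (h2 : altLt y z) : altLt x z := by
  obtain ⟨k, hk, hk'⟩ := h1
  obtain ⟨m, hm, hm'⟩ := h2
  rcases lt_trichotomy k m with h | h | h
  · refine ⟨k, fun i hi => (hk i hi).trans (hm i (hi.trans h)), ?_⟩
    rw [← hm k h]; exact hk'
  · subst h
    refine ⟨k, fun i hi => (hk i hi).trans (hm i hi), ?_⟩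
    split_ifs at * <;> omega
  · refine ⟨m, fun i hi => (hk i (hi.trans h)).trans (hm i hi), ?_⟩
    rw [hk m h]; exact hm'

theorem altLt_asymm {x y : ℕ → ℕ} (h1 : altLt x y) : ¬ altLt y x :=
  fun h2 => altLt_irrefl x (altLt_trans h1 h2)

theorem first_diff {x y : ℕ → ℕ} (h : x ≠ y) : ∃ n, (∀ i < n, x i = y i) ∧ x n ≠ y n := by
  classical
  have h' : ∃ n, x n ≠ y n := by
    by_contra hc; push Not at hc; exact h (funext hc)
  refine ⟨Nat.find h', fun i hi => ?_, Nat.find_spec h'⟩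
  by_contra hc
  exact Nat.find_min h' hi hc

theorem altLt_total {x y : ℕ → ℕ} (h : x ≠ y) : altLt x y ∨ altLt y x := by
  obtain ⟨n, hn, hne⟩ := first_diff h
  by_cases he : Even n
  · rcases lt_or_gt_of_ne hne with h | h
    · right; exact ⟨n, fun i hi => (hn i hi).symm, by simp [he, h]⟩
    · left; exact ⟨n, hn, by simp [he, h]⟩
  · rcases lt_or_gt_of_ne hne with h | h
    · left; exact ⟨n, hn, by simp [he, h]⟩
    · right; exact ⟨n, fun i hi => (hn i hi).symm, by simp [he, h]⟩

theorem not_altLt {x y : ℕ → ℕ} : ¬ altLt x y ↔ altLe y x := by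
  constructor
  · intro h
    by_cases he : y = x
    · exact Or.inl he
    · rcases altLt_total he with h' | h'
      · exact Or.inr h'
      · exact absurd h' h
  · rintro (rfl | h)
    · exact altLt_irrefl _
    · exact altLt_asymm h

theorem not_altLe {x y : ℕ → ℕ} : ¬ altLe x y ↔ altLt y x := by
  rw [← not_altLt, not_not]

theorem altLe_refl (x : ℕ → ℕ) : altLe x x := Or.inl rfl

theorem altLt_le {x y z : ℕ → ℕ} (h1 : altLt x y) (h2 : altLe y z) : altLt x z := by
  rcases h2 with rfl | h2
  · exact h1
  · exact altLt_trans h1 h2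

theorem altLe_lt {x y z : ℕ → ℕ} (h1 : altLe x y) (h2 : altLt y z) : altLt x z := by
  rcases h1 with rfl | h1
  · exact h2
  · exact altLt_trans h1 h2

theorem altLe_trans {x y z : ℕ → ℕ} (h1 : altLe x y) (h2 : altLe y z) : altLe x z := by
  rcases h1 with rfl | h1
  · exact h2
  · exact Or.inr (altLt_le h1 h2)

theorem altLe_antisymm {x y : ℕ → ℕ} (h1 : altLe x y) (h2 : altLe y x) : x = y := by
  rcases h1 with h | h
  · exact h
  · exact absurd h (not_altLt.2 h2)

/-- sequences close to the right of a strict inequality -/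
theorem altLt_agree_right {x y : ℕ → ℕ} (h : altLt x y) :
    ∃ N, ∀ y' : ℕ → ℕ, (∀ i < N, y' i = y i) → altLt x y' := by
  obtain ⟨n, hn, hn'⟩ := h
  refine ⟨n + 1, fun y' hy => ⟨n, fun i hi => ?_, ?_⟩⟩
  · rw [hy i (by omega)]; exact hn i hi
  · rw [hy n (by omega)]; exact hn'

theorem altLt_agree_left {x y : ℕ → ℕ} (h : altLt x y) :
    ∃ N, ∀ x' : ℕ → ℕ, (∀ i < N, x' i = x i) → altLt x' y := by
  obtain ⟨n, hn, hn'⟩ := h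
  refine ⟨n + 1, fun y' hy => ⟨n, fun i hi => ?_, ?_⟩⟩
  · rw [hy i (by omega)]; exact hn i hi
  · rw [hy n (by omega)]; exact hn'

theorem shift_shift (x : ℕ → ℕ) (m n : ℕ) : shiftSeq (shiftSeq x m) n = shiftSeq x (m + n) := by
  funext i; simp [shiftSeq, add_assoc]

theorem shift_zero (x : ℕ → ℕ) : shiftSeq x 0 = x := by
  funext i; simp [shiftSeq]

theorem altLt_shift {x y : ℕ → ℕ} {m : ℕ} (h : ∀ i < m, x i = y i) :
    altLt x y ↔ if Even m then altLt (shiftSeq x m) (shiftSeq y m)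
      else altLt (shiftSeq y m) (shiftSeq x m) := by
  constructor
  · rintro ⟨k, hk, hk'⟩
    have hmk : m ≤ k := by
      by_contra hc
      have := h k (by omega)
      split_ifs at hk' <;> omega
    obtain ⟨j, rfl⟩ := Nat.exists_eq_add_of_le hmk
    by_cases hm : Even m
    · simp only [hm, if_true]
      refine ⟨j, fun i hi => hk _ (by omega), ?_⟩
      simpa [shiftSeq, Nat.even_add, hm] using hk'
    · simp only [hm, if_false]
      refine ⟨j, fun i hi => (hk _ (by omega)).symm, ?_⟩
      by_cases hj : Even j <;> simpa [shiftSeq, Nat.even_add, hm, hj] using hk'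
  · intro H
    by_cases hm : Even m
    · simp only [hm, if_true] at H
      obtain ⟨j, hj, hj'⟩ := H
      refine ⟨m + j, fun i hi => ?_, ?_⟩
      · by_cases him : i < m
        · exact h i him
        · obtain ⟨l, rfl⟩ := Nat.exists_eq_add_of_le (not_lt.1 him)
          exact hj l (by omega)
      · simpa [shiftSeq, Nat.even_add, hm] using hj'
    · simp only [hm, if_false] at H
      obtain ⟨j, hj, hj'⟩ := H
      refine ⟨m + j, fun i hi => ?_, ?_⟩
      · by_cases him : i < m
        · exact h i him
        · obtain ⟨l, rfl⟩ := Nat.exists_eq_add_of_le (not_lt.1 him)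
          exact (hj l (by omega)).symm
      · by_cases hj2 : Even j <;> simpa [shiftSeq, Nat.even_add, hm, hj2] using hj'

theorem eq_of_shift {x y : ℕ → ℕ} {m : ℕ} (h : ∀ i < m, x i = y i)
    (h2 : shiftSeq x m = shiftSeq y m) : x = y := by
  funext i
  by_cases him : i < m
  · exact h i him
  · obtain ⟨l, rfl⟩ := Nat.exists_eq_add_of_le (not_lt.1 him)
    exact congrFun h2 l

theorem altLe_shift_even {x y : ℕ → ℕ} {m : ℕ} (h : ∀ i < m, x i = y i) (hm : Even m) :
    altLe x y ↔ altLe (shiftSeq x m) (shiftSeq y m) := by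
  rw [← not_altLt, ← not_altLt, altLt_shift (fun i hi => (h i hi).symm), if_pos hm]

theorem altLe_shift_odd {x y : ℕ → ℕ} {m : ℕ} (h : ∀ i < m, x i = y i) (hm : ¬ Even m) :
    altLe x y ↔ altLe (shiftSeq y m) (shiftSeq x m) := by
  rw [← not_altLt, ← not_altLt, altLt_shift (fun i hi => (h i hi).symm), if_neg hm]

/-! ### the transformation in the coordinate `u = x - l` -/

noncomputable def T (β u : ℝ) : ℝ := Int.fract (β * (1 - u))

noncomputable def orb (β u : ℝ) : ℕ → ℝ
  | 0 => u
  | n + 1 => T β (orb β u n)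

noncomputable def dg (β u : ℝ) (n : ℕ) : ℕ := ⌊β * (1 - orb β u n)⌋₊

theorem orb_add (β u : ℝ) (m n : ℕ) : orb β u (m + n) = orb β (orb β u m) n := by
  induction n with
  | zero => rfl
  | succ n ih => rw [← add_assoc, orb, ih, orb]

theorem dg_add (β u : ℝ) (m n : ℕ) : dg β u (m + n) = dg β (orb β u m) n := by
  simp [dg, orb_add]

theorem dg_shift (β u : ℝ) (m : ℕ) : shiftSeq (dg β u) m = dg β (orb β u m) := by
  funext n; exact dg_add β u m n

theorem T_mem (β u : ℝ) : 0 ≤ T β u ∧ T β u < 1 := ⟨Int.fract_nonneg _, Int.fract_lt_one _⟩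

theorem orb_mem {β u : ℝ} (h0 : 0 ≤ u) (h1 : u < 1) (n : ℕ) :
    0 ≤ orb β u n ∧ orb β u n < 1 := by
  cases n with
  | zero => exact ⟨h0, h1⟩
  | succ n => exact T_mem _ _

theorem orb_succ {β u : ℝ} (hβ : 0 < β) (h0 : 0 ≤ u) (h1 : u < 1) (n : ℕ) :
    orb β u (n + 1) = β * (1 - orb β u n) - dg β u n := by
  have h := orb_mem (β := β) h0 h1 n
  have hnn : 0 ≤ β * (1 - orb β u n) := by
    apply mul_nonneg hβ.le; linarith [h.2]
  rw [orb, T, Int.fract, dg, natCast_floor_eq_intCast_floor hnn]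

/-- one step computed from a bracket -/
theorem dg_step {β v : ℝ} {e : ℕ} {n : ℕ} {u : ℝ} (hv : orb β u n = v)
    (h0 : 0 ≤ β * (1 - v) - e) (h1 : β * (1 - v) - e < 1) :
    dg β u n = e ∧ orb β u (n + 1) = β * (1 - v) - e := by
  have hf : ⌊β * (1 - v)⌋ = (e : ℤ) := by
    rw [Int.floor_eq_iff]; constructor <;> push_cast <;> linarith
  constructor
  · rw [dg, hv, Nat.floor_eq_iff (by linarith [Nat.cast_nonneg (α := ℝ) e])]
    constructor <;> linarith
  · rw [orb, T, hv, Int.fract, hf]; simp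

theorem link_orb {β : ℝ} (hβ : 1 < β) (n : ℕ) :
    (negBetaT β)^[n] (-β / (β + 1)) = orb β 0 n - β / (β + 1) := by
  have hb : β + 1 ≠ 0 := by linarith
  induction n with
  | zero => simp [orb]; ring
  | succ n ih =>
    rw [Function.iterate_succ_apply', ih, orb, T, negBetaT, Int.fract]
    have e1 : -β * (orb β 0 n - β / (β + 1)) + β / (β + 1) = β * (1 - orb β 0 n) := by
      field_simp; ring
    rw [e1, ← e1]; ring

theorem link_dig {β : ℝ} (hβ : 1 < β) (n : ℕ) :
    ⌊-β * (negBetaT β)^[n] (-β / (β + 1)) + β / (β + 1)⌋ = (dg β 0 n : ℤ) := by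
  have hb : β + 1 ≠ 0 := by linarith
  rw [link_orb hβ, dg]
  have e1 : -β * (orb β 0 n - β / (β + 1)) + β / (β + 1) = β * (1 - orb β 0 n) := by
    field_simp; ring
  rw [e1]
  have h := orb_mem (β := β) (u := 0) le_rfl one_pos n
  rw [Int.natCast_floor_eq_floor]
  apply mul_nonneg (by linarith); linarith [h.2]

end NB



namespace NB

/-- A real trajectory driven by digits `x`. -/
def Traj (γ : ℝ) (x : ℕ → ℕ) (v : ℕ → ℝ) : Prop := ∀ n, v (n + 1) = γ * (1 - v n) - x n

theorem traj_agree {γ : ℝ} {x x' : ℕ → ℕ} {v v' : ℕ → ℝ} (h : Traj γ x v) (h' : Traj γ x' v')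
    (n : ℕ) (ha : ∀ i < n, x i = x' i) : v n - v' n = (-γ) ^ n * (v 0 - v' 0) := by
  induction n with
  | zero => simp
  | succ n ih =>
    rw [h n, h' n, ha n (by omega), pow_succ]
    have := ih (fun i hi => ha i (by omega))
    linear_combination (-γ) * this

theorem traj_shift {γ : ℝ} {x : ℕ → ℕ} {v : ℕ → ℝ} (h : Traj γ x v) (m : ℕ) :
    Traj γ (shiftSeq x m) (fun n => v (m + n)) := fun n => h (m + n)

theorem traj_orb {β u : ℝ} (hβ : 0 < β) (h0 : 0 ≤ u) (h1 : u < 1) :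
    Traj β (dg β u) (orb β u) := fun n => orb_succ hβ h0 h1 n

theorem unbdd_of_ratio {γ : ℝ} (hγ : 1 < γ) {a C : ℝ} (h : ∀ n : ℕ, γ ^ n * |a| ≤ C) : a = 0 := by
  by_contra ha
  have hpos : 0 < |a| := abs_pos.2 ha
  obtain ⟨n, hn⟩ := pow_unbounded_of_one_lt (C / |a|) hγ
  rw [div_lt_iff₀ hpos] at hn
  linarith [h n]

theorem traj_eq {γ : ℝ} (hγ : 1 < γ) {x : ℕ → ℕ} {v v' : ℕ → ℝ} (h : Traj γ x v)
    (h' : Traj γ x v') {C C' : ℝ} (hv : ∀ n, |v n| ≤ C) (hv' : ∀ n, |v' n| ≤ C') :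
    v 0 = v' 0 := by
  have : v 0 - v' 0 = 0 := by
    apply unbdd_of_ratio hγ (C := C + C')
    intro n
    have e := traj_agree h h' n (fun _ _ => rfl)
    have e2 : |v n - v' n| = γ ^ n * |v 0 - v' 0| := by
      rw [e, abs_mul, abs_pow, abs_neg, abs_of_pos (by linarith)]
    rw [← e2]
    have := abs_sub (v n) (v' n)
    linarith [hv n, hv' n]
  linarith

/-- The value function. -/
noncomputable def U (γ : ℝ) (x : ℕ → ℕ) : ℝ :=
  γ / (γ + 1) - (1 / γ) * ∑' j, (-(1 / γ)) ^ j * (x j : ℝ)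

theorem U_summable {γ : ℝ} (hγ : 1 < γ) {x : ℕ → ℕ} {N : ℕ} (hx : ∀ i, x i ≤ N) :
    Summable (fun j => (-(1 / γ)) ^ j * (x j : ℝ)) := by
  have hz : 1 / γ < 1 := by rw [div_lt_one (by linarith)]; exact hγ
  have hz0 : 0 < 1 / γ := by positivity
  apply Summable.of_norm_bounded (g := fun j => (1 / γ) ^ j * N)
  · exact (summable_geometric_of_lt_one hz0.le hz).mul_right _
  · intro j
    rw [norm_mul, norm_pow, norm_neg, Real.norm_of_nonneg hz0.le, Real.norm_of_nonneg (by positivity)]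
    have : (x j : ℝ) ≤ N := by exact_mod_cast hx j
    gcongr

theorem U_bdd {γ : ℝ} (hγ : 1 < γ) {N : ℕ} : ∃ C, ∀ x : ℕ → ℕ, (∀ i, x i ≤ N) → |U γ x| ≤ C := by
  have hz : 1 / γ < 1 := by rw [div_lt_one (by linarith)]; exact hγ
  have hz0 : 0 < 1 / γ := by positivity
  refine ⟨|γ / (γ + 1)| + (1 / γ) * ∑' j, (1 / γ) ^ j * (N : ℝ), fun x hx => ?_⟩
  have hs : Summable (fun j => (1 / γ) ^ j * (N : ℝ)) :=
    (summable_geometric_of_lt_one hz0.le hz).mul_right _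
  have h2 : |∑' j, (-(1 / γ)) ^ j * (x j : ℝ)| ≤ ∑' j, (1 / γ) ^ j * (N : ℝ) := by
    rw [← Real.norm_eq_abs]
    apply tsum_of_norm_bounded hs.hasSum
    intro j
    rw [norm_mul, norm_pow, norm_neg, Real.norm_of_nonneg hz0.le, Real.norm_of_nonneg (by positivity)]
    have : (x j : ℝ) ≤ N := by exact_mod_cast hx j
    gcongr
  unfold U
  refine (abs_sub _ _).trans ?_
  rw [abs_mul, abs_of_pos hz0]
  gcongr

theorem U_step {γ : ℝ} (hγ : 1 < γ) {x : ℕ → ℕ} {N : ℕ} (hx : ∀ i, x i ≤ N) :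
    U γ (shiftSeq x 1) = γ * (1 - U γ x) - x 0 := by
  have h := (U_summable hγ hx).tsum_eq_zero_add
  have h2 : ∑' j, (-(1 / γ)) ^ (j + 1) * (x (j + 1) : ℝ)
      = (-(1 / γ)) * ∑' j, (-(1 / γ)) ^ j * (shiftSeq x 1 j : ℝ) := by
    rw [← tsum_mul_left]
    congr 1; funext j
    simp only [shiftSeq, add_comm 1 j]; ring
  unfold U
  rw [h, h2]
  have : γ ≠ 0 := by linarith
  have : γ + 1 ≠ 0 := by linarith
  field_simp
  ring

theorem U_traj {γ : ℝ} (hγ : 1 < γ) {x : ℕ → ℕ} {N : ℕ} (hx : ∀ i, x i ≤ N) :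
    Traj γ x (fun n => U γ (shiftSeq x n)) := by
  intro n
  have := U_step hγ (x := shiftSeq x n) (N := N) (fun i => hx _)
  rw [shift_shift] at this
  simpa [shiftSeq] using this

theorem U_eq {γ : ℝ} (hγ : 1 < γ) {x : ℕ → ℕ} {N : ℕ} (hx : ∀ i, x i ≤ N) {v : ℕ → ℝ}
    (h : Traj γ x v) {C : ℝ} (hv : ∀ n, |v n| ≤ C) (n : ℕ) : v n = U γ (shiftSeq x n) := by
  obtain ⟨C', hC'⟩ := U_bdd hγ (N := N)
  have := traj_eq hγ (traj_shift h n) (U_traj hγ (x := shiftSeq x n) (N := N) (fun i => hx _))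
    (C := C) (C' := C') (fun i => hv _) (fun i => hC' _ (fun j => hx _))
  simpa [shift_zero] using this

theorem dg_bdd {β u : ℝ} (hβ : 1 < β) (h0 : 0 ≤ u) (h1 : u < 1) (n : ℕ) : dg β u n ≤ ⌊β⌋₊ := by
  apply Nat.floor_le_floor
  have := orb_mem (β := β) h0 h1 n
  nlinarith

theorem orb_eq_U {β u : ℝ} (hβ : 1 < β) (h0 : 0 ≤ u) (h1 : u < 1) (n : ℕ) :
    orb β u n = U β (shiftSeq (dg β u) n) :=
  U_eq hβ (dg_bdd hβ h0 h1) (traj_orb (by linarith) h0 h1) (C := 1)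
    (fun n => abs_le.2 ⟨by linarith [(orb_mem (β := β) h0 h1 n).1],
      (orb_mem (β := β) h0 h1 n).2.le⟩) n

theorem U_dg {β u : ℝ} (hβ : 1 < β) (h0 : 0 ≤ u) (h1 : u < 1) : U β (dg β u) = u := by
  have := orb_eq_U hβ h0 h1 0
  rw [shift_zero] at this
  exact this.symm

/-- difference of initial values at the first digit difference -/
theorem traj_diff {β : ℝ} (hβ : 1 < β) {x x' : ℕ → ℕ} {v v' : ℕ → ℝ} (h : Traj β x v)
    (h' : Traj β x' v') (n : ℕ) (ha : ∀ i < n, x i = x' i) :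
    (-β) ^ n * (v 0 - v' 0) * β = (x' n : ℝ) - x n + v' (n + 1) - v (n + 1) := by
  rw [← traj_agree h h' n ha, h n, h' n]; ring

theorem lt_of_altLt {β u u' : ℝ} (hβ : 1 < β) (h0 : 0 ≤ u) (h1 : u < 1) (h0' : 0 ≤ u')
    (h1' : u' < 1) (h : altLt (dg β u) (dg β u')) : u < u' := by
  obtain ⟨n, hn, hn'⟩ := h
  have e := traj_diff hβ (traj_orb (by linarith) h0 h1) (traj_orb (by linarith) h0' h1') n hn
  have a := orb_mem (β := β) h0 h1 (n + 1)
  have b := orb_mem (β := β) h0' h1' (n + 1)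
  simp only [orb] at e
  simp only [orb] at a b
  have hp : 0 < β ^ n * β := by positivity
  by_cases hev : Even n
  · rw [if_pos hev] at hn'
    have hn2 : (dg β u' n : ℝ) + 1 ≤ dg β u n := by exact_mod_cast hn'
    rw [hev.neg_pow] at e
    nlinarith
  · rw [if_neg hev] at hn'
    have hn2 : (dg β u n : ℝ) + 1 ≤ dg β u' n := by exact_mod_cast hn'
    rw [(Nat.not_even_iff_odd.1 hev).neg_pow] at e
    nlinarith

theorem dg_inj {β u u' : ℝ} (hβ : 1 < β) (h0 : 0 ≤ u) (h1 : u < 1) (h0' : 0 ≤ u')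
    (h1' : u' < 1) (h : dg β u = dg β u') : u = u' := by
  rw [← U_dg hβ h0 h1, ← U_dg hβ h0' h1', h]

theorem altLe_of_le {β u u' : ℝ} (hβ : 1 < β) (h0 : 0 ≤ u) (h1 : u < 1) (h0' : 0 ≤ u')
    (h1' : u' < 1) (h : u ≤ u') : altLe (dg β u) (dg β u') := by
  rw [← not_altLt]
  intro hc
  linarith [lt_of_altLt hβ h0' h1' h0 h1 hc]

theorem altLt_of_lt {β u u' : ℝ} (hβ : 1 < β) (h0 : 0 ≤ u) (h1 : u < 1) (h0' : 0 ≤ u')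
    (h1' : u' < 1) (h : u < u') : altLt (dg β u) (dg β u') := by
  rcases altLe_of_le hβ h0 h1 h0' h1' h.le with e | e
  · exact absurd (dg_inj hβ h0 h1 h0' h1' e) h.ne
  · exact e

/-- the expansion of `l_β` -/
noncomputable abbrev dig (β : ℝ) : ℕ → ℕ := dg β 0

theorem dig_lyndon {β : ℝ} (hβ : 1 < β) : IsAltLyndon (dig β) := by
  intro n
  rw [dg_shift]
  have := orb_mem (β := β) (u := 0) le_rfl one_pos n
  exact altLe_of_le hβ le_rfl one_pos this.1 this.2 this.1

theorem orb_eq_zero_iff {β : ℝ} (hβ : 1 < β) (n : ℕ) :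
    orb β 0 n = 0 ↔ shiftSeq (dig β) n = dig β := by
  have := orb_mem (β := β) (u := 0) le_rfl one_pos n
  rw [dg_shift]
  constructor
  · intro h; rw [h]
  · intro h; exact dg_inj hβ this.1 this.2 le_rfl one_pos h

theorem lemW {β : ℝ} (hβ : 1 < β) {x : ℕ → ℕ} {N : ℕ} (hx : ∀ i, x i ≤ N)
    (hd : ∀ n, altLe (dig β) (shiftSeq x n)) (j : ℕ) :
    0 ≤ U β (shiftSeq x j) ∧ U β (shiftSeq x j) ≤ 1 := by
  set w : ℕ → ℝ := fun n => U β (shiftSeq x n) with hw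
  have ht : Traj β x w := U_traj hβ hx
  obtain ⟨C, hC⟩ := U_bdd hβ (N := N)
  have hbd : BddBelow (Set.range w) := by
    refine ⟨-C, ?_⟩
    rintro _ ⟨n, rfl⟩
    exact (abs_le.1 (hC (shiftSeq x n) (fun i => hx _))).1
  set s := ⨅ n, w n with hs
  have hsle : ∀ n, s ≤ w n := fun n => ciInf_le hbd n
  have hup : ∀ n, w n * β ≤ β - s := by
    intro n
    have h1 := ht n
    have h2 := hsle (n + 1)
    have h3 : (0 : ℝ) ≤ x n := Nat.cast_nonneg _
    nlinarith
  have hs0 : 0 ≤ s := by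
    by_contra hneg
    push Not at hneg
    have key : ∀ n, s / β ^ 2 ≤ w n := by
      intro n
      have hb2 : 0 < β ^ 2 := by positivity
      rw [div_le_iff₀ hb2]
      by_cases hE : shiftSeq x n = dig β
      · have : w n = 0 := by
          show U β (shiftSeq x n) = 0
          rw [hE]; exact U_dg hβ le_rfl one_pos
        rw [this]; linarith
      · rcases hd n with h | h
        · exact absurd h.symm hE
        obtain ⟨m, hm, hm'⟩ := h
        have e := traj_diff hβ (traj_shift ht n) (traj_orb (β := β) (u := 0) (by linarith) le_rfl one_pos) m
          (fun i hi => (hm i hi).symm)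
        have a := orb_mem (β := β) (u := 0) le_rfl one_pos (m + 1)
        have h1 := hsle (n + (m + 1))
        have h2 := hup (n + (m + 1))
        simp only [add_zero] at e
        rw [show orb β 0 0 = 0 from rfl, sub_zero] at e
        by_cases hwn : 0 ≤ w n
        · nlinarith
        push Not at hwn
        by_cases hev : Even m
        · rw [if_pos hev] at hm'
          have hn2 : (shiftSeq x n m : ℝ) + 1 ≤ dg β 0 m := by exact_mod_cast hm'
          rw [hev.neg_pow] at e
          have h3 : 1 ≤ β ^ m := one_le_pow₀ hβ.le
          have h4 : s ≤ β ^ m * w n * β * β := by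
            rw [e]; nlinarith
          nlinarith [mul_nonneg (sub_nonneg.2 h3) (mul_nonneg (neg_nonneg.2 hwn.le) hb2.le)]
        · rw [if_neg hev] at hm'
          have hn2 : (dg β 0 m : ℝ) + 1 ≤ shiftSeq x n m := by exact_mod_cast hm'
          rw [(Nat.not_even_iff_odd.1 hev).neg_pow] at e
          have hm1 : 1 ≤ m := by
            rcases Nat.eq_zero_or_pos m with h | h
            · subst h; simp at hev
            · exact h
          have h3 : β ^ 1 ≤ β ^ m := pow_le_pow_right₀ hβ.le hm1
          rw [pow_one] at h3
          have h4 : s ≤ β ^ m * w n * β := by nlinarith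
          nlinarith [mul_nonneg (sub_nonneg.2 h3) (mul_nonneg (neg_nonneg.2 hwn.le) (by linarith : (0:ℝ) ≤ β))]
    have h5 : s / β ^ 2 ≤ s := le_ciInf key
    have hb2 : 1 < β ^ 2 := one_lt_pow₀ hβ (by norm_num)
    rw [div_le_iff₀ (by linarith)] at h5
    nlinarith
  refine ⟨hs0.trans (hsle j), ?_⟩
  have := hup j
  show w j ≤ 1
  nlinarith

end NB



namespace NB

open MeasureTheory in
theorem transfer_contr {g : ℝ → ℝ} {C β z τ : ℝ} {K : ℕ} (hβ : 1 < β) (hz : 0 ≤ z)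
    (hzβ : z * β < 1) (hK : β ≤ K) (hm : Measurable g) (h0 : ∀ t, 0 ≤ g t) (hC : ∀ t, g t ≤ C)
    (hneg : ∀ t, t < 0 → g t = 0) (B : Set ℝ) (hB : B.Countable)
    (hle : ∀ t ∈ Set.Ioo (0:ℝ) 1, t ∉ B → g t ≤ z * ∑ k ∈ Finset.range K, g (1 - (t + k) / β))
    (hτ0 : 0 ≤ τ) (hτ1 : τ < 1) (hτ : ∀ t, τ < t → t < 1 → 1 / 2 ≤ g t) : False := by
  have hb0 : β ≠ 0 := by linarith
  have hbp : 0 < β := by linarith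
  have hInt : ∀ (f : ℝ → ℝ), Measurable f → (∀ t, 0 ≤ f t) → (∀ t, f t ≤ C) →
      ∀ a b, IntervalIntegrable f volume a b := by
    intro f hf h0 hC a b
    rw [intervalIntegrable_iff]
    apply Measure.integrableOn_of_bounded (M := C)
    · simp
    · exact hf.aestronglyMeasurable
    · exact Eventually.of_forall (fun t => by rw [Real.norm_of_nonneg (h0 t)]; exact hC t)
  have hmk : ∀ k : ℕ, Measurable (fun t : ℝ => g (1 - (t + k) / β)) := fun k =>
    hm.comp (by fun_prop)
  have hIntk : ∀ (k : ℕ) a b, IntervalIntegrable (fun t : ℝ => g (1 - (t + k) / β)) volume a b :=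
    fun k a b => hInt _ (hmk k) (fun t => h0 _) (fun t => hC _) a b
  have hgi := hInt g hm h0 hC
  have h1 : ∫ t in (0:ℝ)..1, g t
      ≤ ∫ t in (0:ℝ)..1, z * ∑ k ∈ Finset.range K, g (1 - (t + k) / β) := by
    apply intervalIntegral.integral_mono_ae_restrict zero_le_one (hgi 0 1)
    · apply IntervalIntegrable.const_mul
      have e : (fun t : ℝ => ∑ k ∈ Finset.range K, g (1 - (t + k) / β))
          = ∑ k ∈ Finset.range K, fun t : ℝ => g (1 - (t + k) / β) := by
        funext t; simp
      rw [e]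
      exact IntervalIntegrable.sum (Finset.range K) (fun k _ => hIntk k 0 1)
    · have e1 : ∀ᵐ t : ℝ, t ∉ B := hB.ae_notMem volume
      have e2 : ∀ᵐ t : ℝ, t ∉ ({0, 1} : Set ℝ) := (Set.toFinite _).countable.ae_notMem volume
      have e3 : ∀ᵐ t ∂(volume.restrict (Set.Icc (0:ℝ) 1)), t ∈ Set.Icc (0:ℝ) 1 :=
        ae_restrict_mem measurableSet_Icc
      filter_upwards [ae_restrict_of_ae e1, ae_restrict_of_ae e2, e3] with t ht1 ht2 ht3
      simp only [Set.mem_insert_iff, Set.mem_singleton_iff, not_or] at ht2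
      exact hle t ⟨lt_of_le_of_ne ht3.1 (Ne.symm ht2.1), lt_of_le_of_ne ht3.2 ht2.2⟩ ht1
  rw [intervalIntegral.integral_const_mul,
    intervalIntegral.integral_finsetSum (fun k _ => hIntk k 0 1)] at h1
  have h2 : ∀ k : ℕ, ∫ t in (0:ℝ)..1, g (1 - (t + k) / β)
      = - (β * ∫ t in (1 - (k:ℝ) / β)..(1 - ((k + 1 : ℕ):ℝ) / β), g t) := by
    intro k
    have := intervalIntegral.integral_comp_sub_div (a := (0:ℝ)) (b := 1) g hb0 (1 - (k:ℝ) / β)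
    have e : ∀ t : ℝ, 1 - (t + k) / β = 1 - (k:ℝ) / β - t / β := by intro t; ring
    simp only [e]
    rw [this, smul_eq_mul, intervalIntegral.integral_symm]
    have e4 : 1 - (k:ℝ) / β - 0 / β = 1 - (k:ℝ) / β := by ring
    have e5 : 1 - (k:ℝ) / β - 1 / β = 1 - ((k + 1 : ℕ):ℝ) / β := by push_cast; ring
    rw [e4, e5]; ring
  simp only [h2] at h1
  rw [Finset.sum_neg_distrib, ← Finset.mul_sum,
    intervalIntegral.sum_integral_adjacent_intervals (a := fun k : ℕ => 1 - (k:ℝ) / β)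
      (fun k _ => hgi _ _), intervalIntegral.integral_symm (1 - (K:ℝ) / β)] at h1
  have h3 : ∫ t in (1 - (K:ℝ) / β)..(1 - ((0:ℕ):ℝ) / β), g t = ∫ t in (0:ℝ)..1, g t := by
    have e : (1 - ((0:ℕ):ℝ) / β) = 1 := by simp
    rw [e, ← intervalIntegral.integral_add_adjacent_intervals (hgi (1 - (K:ℝ) / β) 0) (hgi 0 1)]
    have : ∫ t in (1 - (K:ℝ) / β)..0, g t = 0 := by
      have hle : 1 - (K:ℝ) / β ≤ 0 := by
        rw [sub_nonpos, le_div_iff₀ hbp]; linarith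
      rw [intervalIntegral.integral_of_le hle, integral_Ioc_eq_integral_Ioo]
      rw [setIntegral_congr_fun measurableSet_Ioo (g := fun _ => (0:ℝ))]
      · simp
      · intro t ht; exact hneg t ht.2
    rw [this, zero_add]
  rw [h3] at h1
  have h4 : ∫ t in (0:ℝ)..1, g t ≥ (1 - τ) / 2 := by
    rw [← intervalIntegral.integral_add_adjacent_intervals (hgi 0 τ) (hgi τ 1)]
    have a1 : 0 ≤ ∫ t in (0:ℝ)..τ, g t :=
      intervalIntegral.integral_nonneg hτ0 (fun t _ => h0 t)
    have a2 : ∫ t in τ..1, (1/2 : ℝ) ≤ ∫ t in τ..1, g t :=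
      intervalIntegral.integral_mono_on_of_le_Ioo hτ1.le (by simp) (hgi τ 1)
        (fun t ht => hτ t ht.1 ht.2)
    rw [intervalIntegral.integral_const, smul_eq_mul] at a2
    linarith
  nlinarith

noncomputable def chi (y t : ℝ) : ℝ := if 0 ≤ t ∧ t < y then 1 else 0

theorem chi_nonneg (y t : ℝ) : 0 ≤ chi y t := by unfold chi; split_ifs <;> norm_num
theorem chi_le (y t : ℝ) : chi y t ≤ 1 := by unfold chi; split_ifs <;> norm_num

theorem chi_meas (y : ℝ) : Measurable (chi y) := by
  unfold chi
  exact Measurable.ite (measurableSet_Ici.inter measurableSet_Iio) measurable_const measurable_const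

theorem count_le {K n : ℕ} (hn : n < K) {t r : ℝ} (ht : 0 < t) (ht1 : t < 1) (hr : 0 ≤ r) (hr1 : r < 1)
    (hne : t ≠ r) :
    ∑ k ∈ Finset.range K, (if t + k ≤ n + r then (1:ℝ) else 0) = n + chi r t := by
  have key : ∀ k : ℕ, (if t + k ≤ n + r then (1:ℝ) else 0)
      = (if k < n then 1 else 0) + (if k = n then chi r t else 0) := by
    intro k
    rcases lt_trichotomy k n with h | h | h
    · have : (k:ℝ) + 1 ≤ n := by exact_mod_cast h
      rw [if_pos (by linarith), if_pos h, if_neg (by omega)]; simp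
    · subst h
      simp only [lt_irrefl, if_false, if_true, zero_add, chi]
      by_cases hc : t < r
      · rw [if_pos (by linarith), if_pos ⟨ht.le, hc⟩]
      · have : r < t := lt_of_le_of_ne (not_lt.1 hc) (Ne.symm hne)
        rw [if_neg (by linarith), if_neg (by tauto)]
    · have : (n:ℝ) + 1 ≤ k := by exact_mod_cast h
      rw [if_neg (by linarith), if_neg (by omega), if_neg (by omega)]; simp
  simp only [key, Finset.sum_add_distrib]
  congr 1
  · rw [← Finset.sum_filter, Finset.sum_const]
    have : (Finset.range K).filter (fun k => k < n) = Finset.range n := by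
      ext k; simp; omega
    rw [this]; simp
  · simp [hn]

theorem lemPos {β γ : ℝ} (hβ : 1 < β) (hγ : β < γ) {x : ℕ → ℕ} {w : ℕ → ℝ}
    (hw : ∀ j, 0 ≤ w j ∧ w j < 1) (ht : Traj β x w) : 0 < U γ x := by
  by_contra hU
  push Not at hU
  have hbp : 0 < β := by linarith
  set K : ℕ := ⌊β⌋₊ + 1 with hKdef
  have hK : β < K := by rw [hKdef]; push_cast; exact Nat.lt_floor_add_one β
  have hxβ : ∀ j, (x j : ℝ) ≤ β := by
    intro j
    have := ht j
    nlinarith [(hw j).1, (hw (j+1)).1]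
  have hxK : ∀ j, x j < K := by
    intro j
    have : (x j : ℝ) < K := lt_of_le_of_lt (hxβ j) hK
    exact_mod_cast this
  set z : ℝ := 1 / γ with hzdef
  have hz0 : 0 < z := by
    have : 0 < γ := by linarith
    rw [hzdef]; positivity
  have hz1 : z < 1 := by rw [hzdef, div_lt_one (by linarith)]; linarith
  have hzβ : z * β < 1 := by rw [hzdef, one_div_mul_eq_div, div_lt_one (by linarith)]; exact hγ
  have hgeo : Summable (fun j : ℕ => z ^ j) := summable_geometric_of_lt_one hz0.le hz1
  have hsum : ∀ (a : ℕ → ℝ) (D : ℝ), (∀ j, |a j| ≤ D) → Summable (fun j => (-z) ^ j * a j) := by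
    intro a D ha
    apply Summable.of_norm_bounded (g := fun j => z ^ j * D) (hgeo.mul_right _)
    intro j
    rw [norm_mul, norm_pow, norm_neg, Real.norm_of_nonneg hz0.le]
    gcongr; exact ha j
  have hchiabs : ∀ y t, |chi y t| ≤ 1 := fun y t => by
    rw [abs_of_nonneg (chi_nonneg y t)]; exact chi_le y t
  set M : ℝ → ℝ := fun t => chi 1 t - (1 + z) * ∑' j, (-z) ^ j * chi (w j) t with hM
  have hMm : Measurable M := by
    apply (chi_meas 1).sub
    apply Measurable.const_mul
    exact Measurable.tsum (fun j => (chi_meas (w j)).const_mul _)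
  have htail : ∀ t, |∑' j, (-z) ^ j * chi (w j) t| ≤ ∑' j, z ^ j := by
    intro t
    rw [← Real.norm_eq_abs]
    apply tsum_of_norm_bounded hgeo.hasSum
    intro j
    rw [norm_mul, norm_pow, norm_neg, Real.norm_of_nonneg hz0.le]
    calc z ^ j * ‖chi (w j) t‖ ≤ z ^ j * 1 := by gcongr; exact hchiabs _ _
      _ = z ^ j := mul_one _
  have hMneg : ∀ t, t < 0 → M t = 0 := by
    intro t h
    have : ∀ y, chi y t = 0 := fun y => by unfold chi; rw [if_neg]; rintro ⟨h1, _⟩; linarith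
    simp [hM, this]
  have hgeoneg : ∑' j : ℕ, (-z) ^ j = 1 / (1 + z) := by
    rw [tsum_geometric_of_norm_lt_one]
    · rw [sub_neg_eq_add, one_div]
    · rw [norm_neg, Real.norm_of_nonneg hz0.le]; exact hz1
  have hz1' : (1 + z) ≠ 0 := by linarith
  have hUz : U γ x = 1 / (1 + z) - z * ∑' j, (-z) ^ j * (x j : ℝ) := by
    have : γ / (γ + 1) = 1 / (1 + z) := by
      rw [hzdef]; have : γ ≠ 0 := by linarith
      have : γ + 1 ≠ 0 := by linarith
      field_simp
    unfold U; rw [this]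
  -- transfer identity
  have hident : ∀ t ∈ Set.Ioo (0:ℝ) 1, t ∉ Set.range w →
      M t = z * (∑ k ∈ Finset.range K, M (1 - (t + k) / β)) + (1 + z) * (U γ x - chi (w 0) t) := by
    intro t ht01 htw
    have hchik : ∀ (y : ℝ) (k : ℕ), 0 ≤ y → y ≤ 1 → chi y (1 - (t + k) / β)
        = (if t + k ≤ β then 1 else 0) - (if t + k ≤ β * (1 - y) then 1 else 0) := by
      intro y k hy0 hy
      have e1 : 0 ≤ 1 - (t + k) / β ↔ t + k ≤ β := by
        rw [sub_nonneg, div_le_one hbp]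
      have e2 : 1 - (t + k) / β < y ↔ β * (1 - y) < t + k := by
        rw [sub_lt_comm, lt_div_iff₀ hbp, mul_comm]
      unfold chi
      simp only [e1, e2]
      by_cases h1 : t + k ≤ β * (1 - y)
      · have h2 : t + k ≤ β := by nlinarith
        rw [if_neg (by rintro ⟨_, h⟩; linarith), if_pos h2, if_pos h1]; simp
      · by_cases h2 : t + k ≤ β
        · rw [if_pos ⟨h2, not_le.1 h1⟩, if_pos h2, if_neg h1]; simp
        · rw [if_neg (by tauto), if_neg h2, if_neg h1]; simp
    set S : ℝ := ∑ k ∈ Finset.range K, (if t + k ≤ β then (1:ℝ) else 0) with hS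
    have hone : ∑ k ∈ Finset.range K, chi 1 (1 - (t + k) / β) = S := by
      rw [hS]
      apply Finset.sum_congr rfl
      intro k _
      rw [hchik 1 k zero_le_one le_rfl, sub_self, mul_zero, if_neg (c := t + k ≤ 0)]
      · ring
      · have : (0:ℝ) ≤ k := Nat.cast_nonneg k
        linarith [ht01.1]
    have hwj : ∀ j, ∑ k ∈ Finset.range K, chi (w j) (1 - (t + k) / β)
        = S - x j - chi (w (j+1)) t := by
      intro j
      have e : β * (1 - w j) = x j + w (j+1) := by rw [ht j]; ring
      have := count_le (hxK j) ht01.1 ht01.2 (hw (j+1)).1 (hw (j+1)).2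
        (fun h => htw ⟨j+1, h.symm⟩)
      rw [sub_sub, ← this, ← e, hS, ← Finset.sum_sub_distrib]
      apply Finset.sum_congr rfl
      intro k _
      rw [hchik _ k (hw j).1 (hw j).2.le]
    have hxs : Summable (fun j => (-z) ^ j * (x j : ℝ)) :=
      hsum _ β (fun j => by rw [abs_of_nonneg (Nat.cast_nonneg _)]; exact hxβ j)
    have hcs : Summable (fun j => (-z) ^ j * chi (w (j+1)) t) := hsum _ 1 (fun j => hchiabs _ _)
    have hc0 : Summable (fun j => (-z) ^ j * chi (w j) t) := hsum _ 1 (fun j => hchiabs _ _)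
    have hSs : Summable (fun j : ℕ => (-z) ^ j * S) := hsum (fun _ => S) |S| (fun j => le_rfl)
    have hLM : ∑ k ∈ Finset.range K, M (1 - (t + k) / β)
        = S - (1 + z) * (1 / (1 + z) * S - (∑' j, (-z) ^ j * (x j : ℝ))
          - ∑' j, (-z) ^ j * chi (w (j+1)) t) := by
      simp only [hM]
      rw [Finset.sum_sub_distrib, hone, ← Finset.mul_sum, ← Summable.tsum_finsetSum]
      · congr 2
        rw [← hgeoneg, ← tsum_mul_right, ← hSs.tsum_sub hxs, ← (hSs.sub hxs).tsum_sub hcs]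
        congr 1; funext j
        rw [← Finset.mul_sum, hwj j]; ring
      · intro k _
        exact hsum _ 1 (fun j => hchiabs _ _)
    have hc : ∑' j, (-z) ^ j * chi (w j) t
        = chi (w 0) t - z * ∑' j, (-z) ^ j * chi (w (j+1)) t := by
      rw [hc0.tsum_eq_zero_add, ← tsum_mul_left, sub_eq_add_neg, ← tsum_neg]
      congr 1
      · simp
      · congr 1; funext j; ring
    rw [hLM, hUz]
    simp only [hM]
    rw [hc]
    have : chi 1 t = 1 := by unfold chi; rw [if_pos ⟨ht01.1.le, ht01.2⟩]
    rw [this]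
    field_simp
    ring
  -- behaviour near one
  obtain ⟨τ, hτ0, hτ1, hτ⟩ : ∃ τ, 0 ≤ τ ∧ τ < 1 ∧ ∀ t, τ < t → t < 1 → 1 / 2 ≤ M t := by
    have hlim : Tendsto (fun J => ∑' j, z ^ (j + J)) atTop (𝓝 0) :=
      tendsto_sum_nat_add (fun j => z ^ j)
    have : ∀ᶠ J in atTop, ∑' j, z ^ (j + J) < 1 / 4 := hlim.eventually_lt_const (by norm_num)
    obtain ⟨J, hJ⟩ := this.exists
    obtain ⟨τ, hτ⟩ : ∃ τ, (0 ≤ τ ∧ τ < 1) ∧ ∀ j < J, w j ≤ τ := by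
      clear hJ
      induction J with
      | zero => exact ⟨0, ⟨le_rfl, one_pos⟩, by simp⟩
      | succ J ih =>
        obtain ⟨τ, h1, h2⟩ := ih
        refine ⟨max τ (w J), ⟨le_max_of_le_left h1.1, max_lt h1.2 (hw J).2⟩, ?_⟩
        intro j hj
        rcases Nat.lt_succ_iff_lt_or_eq.1 hj with h | h
        · exact (h2 j h).trans (le_max_left _ _)
        · subst h; exact le_max_right _ _
    refine ⟨τ, hτ.1.1, hτ.1.2, fun t h1 h2 => ?_⟩
    have hc0 : Summable (fun j => (-z) ^ j * chi (w j) t) := hsum _ 1 (fun j => hchiabs _ _)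
    have hchi1 : chi 1 t = 1 := by unfold chi; rw [if_pos ⟨by linarith [hτ.1.1], h2⟩]
    have hb : |∑' j, (-z) ^ j * chi (w j) t| ≤ ∑' j, z ^ (j + J) := by
      rw [← hc0.sum_add_tsum_nat_add J, Finset.sum_eq_zero, zero_add, ← Real.norm_eq_abs]
      · apply tsum_of_norm_bounded ((summable_nat_add_iff J).2 hgeo).hasSum
        intro j
        rw [norm_mul, norm_pow, norm_neg, Real.norm_of_nonneg hz0.le]
        calc z ^ (j+J) * ‖chi (w (j+J)) t‖ ≤ z ^ (j+J) * 1 := by gcongr; exact hchiabs _ _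
          _ = z ^ (j+J) := mul_one _
      · intro j hj
        have : chi (w j) t = 0 := by
          unfold chi; rw [if_neg]; rintro ⟨_, h⟩
          have := hτ.2 j (Finset.mem_range.1 hj); linarith
        rw [this, mul_zero]
    have := (abs_le.1 hb).2
    simp only [hM, hchi1]
    nlinarith
  refine transfer_contr (g := fun t => max (M t) 0) (C := 1 + (1 + z) * ∑' j, z ^ j) (z := z)
    (K := K) hβ hz0.le hzβ hK.le (hMm.max measurable_const) (fun t => le_max_right _ _) ?_ ?_
    (Set.range w) (Set.countable_range w) ?_ hτ0 hτ1 (fun t h1 h2 => le_max_of_le_left (hτ t h1 h2))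
  · intro t
    have h1 := (abs_le.1 (htail t)).1
    have h2 := chi_le 1 t
    have h3 : 0 ≤ ∑' j : ℕ, z ^ j := tsum_nonneg (fun j => by positivity)
    apply max_le
    · simp only [hM]; nlinarith
    · positivity
  · intro t h; simp [hMneg t h]
  · intro t h1 h2
    have hnn : 0 ≤ z * ∑ k ∈ Finset.range K, max (M (1 - (t + k) / β)) 0 :=
      mul_nonneg hz0.le (Finset.sum_nonneg (fun k _ => le_max_right _ _))
    apply max_le _ hnn
    rw [hident t h1 h2]
    have h3 : ∑ k ∈ Finset.range K, M (1 - (t + k) / β)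
        ≤ ∑ k ∈ Finset.range K, max (M (1 - (t + k) / β)) 0 :=
      Finset.sum_le_sum (fun k _ => le_max_left _ _)
    have h4 := chi_nonneg (w 0) t
    have h5 : (1 + z) * (U γ x - chi (w 0) t) ≤ 0 :=
      mul_nonpos_of_nonneg_of_nonpos (by linarith) (by linarith)
    have h6 := mul_le_mul_of_nonneg_left h3 hz0.le
    linarith

end NB



namespace NB

theorem U_dig_pos {β γ : ℝ} (hβ : 1 < β) (hγ : β < γ) : 0 < U γ (dig β) :=
  lemPos hβ hγ (fun j => orb_mem le_rfl one_pos j) (traj_orb (by linarith) le_rfl one_pos)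

theorem dig_bdd {β : ℝ} (hβ : 1 < β) (n : ℕ) : dig β n ≤ ⌊β⌋₊ := dg_bdd hβ le_rfl one_pos n

/-- `β` is not periodic: the orbit of `0` never returns to `0`. -/
def NonPer (β : ℝ) : Prop := ∀ j, 1 ≤ j → orb β 0 j ≠ 0

theorem mono_nonper {β β' : ℝ} (hβ : 1 < β) (hlt : β < β') (hn : NonPer β) :
    altLt (dig β') (dig β) := by
  by_contra hc
  rw [not_altLt] at hc
  have hβ' : 1 < β' := by linarith
  set x := dig β' with hx
  have hxb : ∀ i, x i ≤ ⌊β'⌋₊ := dig_bdd hβ'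
  have hsh : ∀ n, altLe (dig β) (shiftSeq x n) := fun n => altLe_trans hc (dig_lyndon hβ' n)
  have hW := lemW hβ hxb hsh
  set w : ℕ → ℝ := fun n => U β (shiftSeq x n) with hw
  have ht : Traj β x w := U_traj hβ hxb
  have hU0 : U β' x = 0 := U_dg hβ' le_rfl one_pos
  by_cases hall : ∀ j, w j < 1
  · have := lemPos hβ hlt (w := w) (fun j => ⟨(hW j).1, hall j⟩) ht
    linarith
  · push Not at hall
    obtain ⟨j, hj⟩ := hall
    have hj1 : w j = 1 := le_antisymm (hW j).2 hj
    have hj2 : w (j + 1) = 0 := by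
      have h1 := ht j
      have h2 : 0 ≤ w (j+1) := (hW (j + 1)).1
      have h3 : (0:ℝ) ≤ x j := Nat.cast_nonneg _
      rw [hj1] at h1
      linarith
    have ho : Traj β (dig β) (orb β 0) := traj_orb (by linarith) le_rfl one_pos
    have key : ∀ n, w (j + 1 + n) = orb β 0 n ∧ ∀ i < n, shiftSeq x (j + 1) i = dig β i := by
      intro n
      induction n with
      | zero => exact ⟨by rw [add_zero, hj2]; rfl, by simp⟩
      | succ n ih =>
        have e1 := ht (j + 1 + n)
        have e2 := ho n
        have b1 := hW (j + 1 + (n + 1))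
        have b2 := orb_mem (β := β) (u := 0) le_rfl one_pos (n + 1)
        have b3 : 0 < orb β 0 (n + 1) := lt_of_le_of_ne b2.1 (Ne.symm (hn (n+1) (by omega)))
        rw [ih.1] at e1
        have e3 : w (j + 1 + (n+1)) + x (j + 1 + n) = orb β 0 (n+1) + dig β n := by
          rw [e2, ← add_assoc, e1]; ring
        have e4 : x (j + 1 + n) = dig β n := by
          have c1 : (x (j + 1 + n) : ℝ) < dig β n + 1 := by
            have : 0 ≤ w (j + 1 + (n+1)) := b1.1
            linarith
          have c2 : (dig β n : ℝ) < x (j + 1 + n) + 1 := by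
            have : w (j + 1 + (n+1)) ≤ 1 := b1.2
            linarith
          have c1' : x (j + 1 + n) < dig β n + 1 := by exact_mod_cast c1
          have c2' : dig β n < x (j + 1 + n) + 1 := by exact_mod_cast c2
          omega
        refine ⟨?_, ?_⟩
        · rw [e4] at e3; linarith
        · intro i hi
          rcases Nat.lt_succ_iff_lt_or_eq.1 hi with h | h
          · exact ih.2 i h
          · subst h; exact e4
    have he : shiftSeq x (j + 1) = dig β := by
      funext i; exact (key (i + 1)).2 i (by omega)
    have h1 := dig_lyndon hβ' (j + 1)
    rw [← hx, he] at h1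
    have h2 := altLe_antisymm h1 hc
    rw [h2] at hU0
    linarith [U_dig_pos hβ hlt]

/-! ### nonperiodic parameters are dense -/

open Polynomial in
noncomputable def pol (b : ℕ → ℕ) : ℕ → ℤ[X]
  | 0 => 0
  | n + 1 => X * (1 - pol b n) - C (b n : ℤ)

open Polynomial in
theorem pol_coeff (b : ℕ → ℕ) (n : ℕ) : (pol b (n + 1)).coeff (n + 1) = (-1) ^ n := by
  induction n with
  | zero => simp [pol, coeff_C]
  | succ n ih =>
    rw [pol, coeff_sub, coeff_X_mul, coeff_sub, ih, coeff_C, coeff_one]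
    simp [pow_succ]

open Polynomial in
theorem pol_eval {β : ℝ} (hβ : 1 < β) (n : ℕ) : aeval β (pol (dig β) n) = orb β 0 n := by
  induction n with
  | zero => simp [pol, orb]
  | succ n ih =>
    rw [orb_succ (by linarith) le_rfl one_pos, pol]
    simp [ih]

theorem algebraic_of_per {β : ℝ} (hβ : 1 < β) (h : ¬ NonPer β) : IsAlgebraic ℤ β := by
  unfold NonPer at h
  push Not at h
  obtain ⟨j, hj, h0⟩ := h
  obtain ⟨n, rfl⟩ : ∃ n, j = n + 1 := ⟨j - 1, by omega⟩
  refine ⟨pol (dig β) (n + 1), ?_, by rw [pol_eval hβ, h0]⟩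
  intro hz
  have := pol_coeff (dig β) n
  rw [hz] at this
  simp at this
  have h2 := pow_ne_zero n (show (-1 : ℤ) ≠ 0 by norm_num)
  exact h2 this.symm

theorem exists_nonper {a b : ℝ} (ha : 1 ≤ a) (hab : a < b) : ∃ γ, a < γ ∧ γ < b ∧ NonPer γ := by
  by_contra hc
  push Not at hc
  have hcount : (Set.Ioo a b).Countable := by
    apply (Algebraic.countable ℤ ℝ).mono
    intro γ hγ
    exact algebraic_of_per (lt_of_le_of_lt ha hγ.1) (hc γ hγ.1 hγ.2)
  have := Cardinal.mk_Ioo_real hab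
  have h2 := hcount.le_aleph0
  rw [this] at h2
  exact absurd h2 (not_le.2 Cardinal.aleph0_lt_continuum)

/-! ### local analysis -/

noncomputable def lin (γ : ℝ) (b : ℕ → ℕ) (v : ℝ) : ℕ → ℝ
  | 0 => v
  | n + 1 => γ * (1 - lin γ b v n) - b n

theorem lin_traj (γ : ℝ) (b : ℕ → ℕ) (v : ℝ) : Traj γ b (lin γ b v) := fun _ => rfl

theorem lin_affine (γ : ℝ) (b : ℕ → ℕ) (v : ℝ) (n : ℕ) :
    lin γ b v n = lin γ b 0 n + (-γ) ^ n * v := by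
  have := traj_agree (lin_traj γ b v) (lin_traj γ b 0) n (fun _ _ => rfl)
  simp only [lin, sub_zero] at this
  linarith

theorem lin_dig {β : ℝ} (hβ : 1 < β) (n : ℕ) : lin β (dig β) 0 n = orb β 0 n := by
  induction n with
  | zero => rfl
  | succ n ih => rw [lin, ih, orb_succ (by linarith) le_rfl one_pos]

theorem lin_cont (b : ℕ → ℕ) (n : ℕ) : Continuous (fun p : ℝ × ℝ => lin p.1 b p.2 n) := by
  induction n with
  | zero => exact continuous_snd
  | succ n ih => simp only [lin]; fun_prop

theorem follow {γ v : ℝ} {b : ℕ → ℕ} (n : ℕ)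
    (h : ∀ j, 1 ≤ j → j ≤ n → 0 ≤ lin γ b v j ∧ lin γ b v j < 1) :
    (∀ i < n, dg γ v i = b i) ∧ orb γ v n = lin γ b v n := by
  induction n with
  | zero => exact ⟨by simp, rfl⟩
  | succ n ih =>
    obtain ⟨h1, h2⟩ := ih (fun j hj hj' => h j hj (by omega))
    have h3 := h (n + 1) (by omega) le_rfl
    have := dg_step (β := γ) (u := v) (n := n) (e := b n) h2 h3.1 h3.2
    refine ⟨fun i hi => ?_, this.2⟩
    rcases Nat.lt_succ_iff_lt_or_eq.1 hi with h | h
    · exact h1 i h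
    · subst h; exact this.1

theorem local_pref {β : ℝ} (hβ : 1 < β) (n : ℕ) (hn : ∀ j, 1 ≤ j → j ≤ n → orb β 0 j ≠ 0) :
    ∀ᶠ p : ℝ × ℝ in 𝓝 (β, 0), ∀ j, 1 ≤ j → j ≤ n →
      0 < lin p.1 (dig β) p.2 j ∧ lin p.1 (dig β) p.2 j < 1 := by
  have : ∀ j ∈ Finset.Icc 1 n, ∀ᶠ p : ℝ × ℝ in 𝓝 (β, 0),
      0 < lin p.1 (dig β) p.2 j ∧ lin p.1 (dig β) p.2 j < 1 := by
    intro j hj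
    rw [Finset.mem_Icc] at hj
    have h1 := orb_mem (β := β) (u := 0) le_rfl one_pos j
    have h2 := lt_of_le_of_ne h1.1 (Ne.symm (hn j hj.1 hj.2))
    have hc := (lin_cont (dig β) j).tendsto (β, 0)
    simp only [lin_dig hβ] at hc
    exact (hc.eventually_const_lt h2).and (hc.eventually_lt_const h1.2)
  have h2 := (Filter.eventually_all_finset (Finset.Icc 1 n)).2 this
  filter_upwards [h2] with p hp j h1 h2
  exact hp j (Finset.mem_Icc.2 ⟨h1, h2⟩)

theorem ev_prod {P : ℝ → ℝ → Prop} {β : ℝ} (h : ∀ᶠ p : ℝ × ℝ in 𝓝 (β, 0), P p.1 p.2) :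
    ∃ δ > 0, ∀ γ v, |γ - β| < δ → |v| < δ → P γ v := by
  rw [Metric.eventually_nhds_iff] at h
  obtain ⟨δ, hδ, h⟩ := h
  refine ⟨δ, hδ, fun γ v h1 h2 => ?_⟩
  apply h (y := (γ, v))
  rw [Prod.dist_eq, max_lt_iff, Real.dist_eq, Real.dist_eq, sub_zero]
  exact ⟨h1, h2⟩

theorem agree_nonper {β : ℝ} (hβ : 1 < β) (hn : NonPer β) (N : ℕ) :
    ∃ δ > 0, ∀ γ, |γ - β| < δ → ∀ i < N, dig γ i = dig β i := by
  obtain ⟨δ, hδ, h⟩ := ev_prod (P := fun γ v => ∀ j, 1 ≤ j → j ≤ N →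
      0 < lin γ (dig β) v j ∧ lin γ (dig β) v j < 1)
      (local_pref hβ N (fun j hj _ => hn j hj))
  refine ⟨δ, hδ, fun γ hγ => ?_⟩
  exact (follow N (fun j h1 h2 => ⟨(h γ 0 hγ (by simpa using hδ) j h1 h2).1.le,
    (h γ 0 hγ (by simpa using hδ) j h1 h2).2⟩)).1

/-- the modified block -/
def bC (b : ℕ → ℕ) (k : ℕ) : ℕ → ℕ := fun i => if i + 1 = k then b i - 1 else if i = k then 0 else b i

/-- `β` is periodic with minimal period `k`. -/
structure Per (β : ℝ) (k : ℕ) : Prop where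
  one : 1 < β
  pos : 1 ≤ k
  zero : orb β 0 k = 0
  min : ∀ j, 1 ≤ j → j < k → orb β 0 j ≠ 0

theorem per_or {β : ℝ} (hβ : 1 < β) : NonPer β ∨ ∃ k, Per β k := by
  classical
  by_cases h : NonPer β
  · exact Or.inl h
  · right
    unfold NonPer at h
    push Not at h
    have h' : ∃ j, 1 ≤ j ∧ orb β 0 j = 0 := h
    refine ⟨Nat.find h', hβ, (Nat.find_spec h').1, (Nat.find_spec h').2, fun j h1 h2 h3 => ?_⟩
    exact Nat.find_min h' h2 ⟨h1, h3⟩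

theorem Per.last {β : ℝ} {k : ℕ} (h : Per β k) : 1 ≤ dig β (k - 1) := by
  have h1 := orb_succ (β := β) (u := 0) (by linarith [h.one]) le_rfl one_pos (k - 1)
  rw [Nat.sub_add_cancel h.pos, h.zero] at h1
  have h2 := orb_mem (β := β) (u := 0) le_rfl one_pos (k - 1)
  have h3 : (0:ℝ) < dig β (k - 1) := by
    have : 0 < β * (1 - orb β 0 (k-1)) := mul_pos (by linarith [h.one]) (by linarith)
    linarith
  exact_mod_cast h3

theorem Per.period {β : ℝ} {k : ℕ} (h : Per β k) : shiftSeq (dig β) k = dig β :=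
  (orb_eq_zero_iff h.one k).1 h.zero

theorem block {β : ℝ} {k : ℕ} (h : Per β k) : ∃ δ > 0, δ < 1 ∧ ∀ γ v, |γ - β| < δ → 0 ≤ v → v < δ →
    1 < γ ∧ 
    (0 ≤ lin γ (dig β) 0 k + (-γ) ^ k * v → (∀ i < k, dg γ v i = dig β i) ∧
      orb γ v k = lin γ (dig β) 0 k + (-γ) ^ k * v) ∧
    (lin γ (dig β) 0 k + (-γ) ^ k * v < 0 → (∀ i < k + 1, dg γ v i = bC (dig β) k i) ∧
      orb γ v (k + 1) = -γ * (lin γ (dig β) 0 k + (-γ) ^ k * v)) := by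
  have hβ := h.one
  have e1 := local_pref hβ (k - 1) (fun j h1 h2 => h.min j h1 (by have := h.pos; omega))
  have hc := (lin_cont (dig β) k).tendsto (β, 0)
  simp only [lin_dig hβ, h.zero] at hc
  have e2 : ∀ᶠ p : ℝ × ℝ in 𝓝 (β, 0), lin p.1 (dig β) p.2 k < 1 := hc.eventually_lt_const one_pos
  have hc2 : Tendsto (fun p : ℝ × ℝ => -p.1 * lin p.1 (dig β) p.2 k) (𝓝 (β, 0)) (𝓝 0) := by
    have hcc : Continuous (fun p : ℝ × ℝ => -p.1 * lin p.1 (dig β) p.2 k) :=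
      (continuous_fst.neg).mul (lin_cont (dig β) k)
    have := hcc.tendsto (β, 0)
    simp only [lin_dig hβ, h.zero, mul_zero] at this
    exact this
  have e3 : ∀ᶠ p : ℝ × ℝ in 𝓝 (β, 0), -p.1 * lin p.1 (dig β) p.2 k < 1 :=
    hc2.eventually_lt_const one_pos
  have e4 : ∀ᶠ p : ℝ × ℝ in 𝓝 (β, 0), 1 < p.1 :=
    (continuous_fst.tendsto (β, (0:ℝ))).eventually_const_lt hβ
  obtain ⟨δ, hδ, H⟩ := ev_prod (P := fun γ v => ((∀ j, 1 ≤ j → j ≤ k - 1 →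
      0 < lin γ (dig β) v j ∧ lin γ (dig β) v j < 1) ∧ lin γ (dig β) v k < 1 ∧
      -γ * lin γ (dig β) v k < 1 ∧ 1 < γ)) (e1.and (e2.and (e3.and e4)))
  refine ⟨min δ (1/2), by positivity, by linarith [min_le_right δ (1/2:ℝ)], fun γ v hγ hv0 hv => ?_⟩
  obtain ⟨H1, H2, H3, H4⟩ := H γ v (lt_of_lt_of_le hγ (min_le_left _ _))
    (by rw [abs_of_nonneg hv0]; exact lt_of_lt_of_le hv (min_le_left _ _))
  refine ⟨H4, ?_, ?_⟩
  · intro he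
    rw [← lin_affine] at he ⊢
    apply follow
    intro j h1 h2
    rcases eq_or_lt_of_le h2 with rfl | h3
    · exact ⟨he, H2⟩
    · exact ⟨(H1 j h1 (by omega)).1.le, (H1 j h1 (by omega)).2⟩
  · intro he
    rw [← lin_affine] at he ⊢
    obtain ⟨m, rfl⟩ : ∃ m, k = m + 1 := ⟨k - 1, by have := h.pos; omega⟩
    simp only [Nat.add_sub_cancel] at H1
    obtain ⟨f1, f2⟩ := follow (γ := γ) (v := v) (b := dig β) m
      (fun j h1 h2 => ⟨(H1 j h1 h2).1.le, (H1 j h1 h2).2⟩)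
    have hlast := h.last
    simp only [Nat.add_sub_cancel] at hlast
    have hl : lin γ (dig β) v (m + 1) = γ * (1 - lin γ (dig β) v m) - dig β m := rfl
    have hg : lin γ (dig β) v (m + 1) > -1 := by nlinarith
    have hcast : ((dig β m - 1 : ℕ) : ℝ) = (dig β m : ℝ) - 1 := by
      rw [Nat.cast_sub hlast]; simp
    obtain ⟨s1, s2⟩ := dg_step (β := γ) (u := v) (n := m) (e := dig β m - 1) f2
      (by rw [hcast]; linarith) (by rw [hcast]; linarith)
    rw [hcast] at s2
    have s2' : orb γ v (m + 1) = 1 + lin γ (dig β) v (m + 1) := by rw [s2, hl]; ring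
    obtain ⟨s3, s4⟩ := dg_step (β := γ) (u := v) (n := m + 1) (e := 0) s2'
      (by push_cast; nlinarith) (by push_cast; linarith)
    refine ⟨fun i hi => ?_, by rw [s4]; push_cast; ring⟩
    unfold bC
    by_cases hi1 : i + 1 = m + 1
    · have : i = m := by omega
      subst this
      simp [s1]
    · rw [if_neg hi1]
      by_cases hi2 : i = m + 1
      · subst hi2; simp [s3]
      · rw [if_neg hi2]; exact f1 i (by omega)

end NB



namespace NB

theorem cc_small {β : ℝ} {k : ℕ} (h : Per β k) {ε : ℝ} (hε : 0 < ε) :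
    ∃ δ > 0, ∀ γ, |γ - β| < δ → |lin γ (dig β) 0 k| < ε := by
  have hc := (lin_cont (dig β) k).tendsto (β, 0)
  simp only [lin_dig h.one, h.zero] at hc
  have e : ∀ᶠ p : ℝ × ℝ in 𝓝 (β, 0), |lin p.1 (dig β) p.2 k| < ε := by
    have := hc.abs
    simp only [abs_zero] at this
    exact this.eventually_lt_const hε
  obtain ⟨δ, hδ, H⟩ := ev_prod (P := fun γ v => |lin γ (dig β) v k| < ε) e
  exact ⟨δ, hδ, fun γ hγ => H γ 0 hγ (by simpa using hδ)⟩

theorem sign_right {β γ : ℝ} {k : ℕ} (h : Per β k) (hγ : β < γ) :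
    (Even k → lin γ (dig β) 0 k < 0) ∧ (¬ Even k → 0 < lin γ (dig β) 0 k) := by
  have hβ := h.one
  have hg1 : 1 < γ := by linarith
  have hw := U_dig_pos hβ hγ
  have e := traj_agree (U_traj hg1 (dig_bdd hβ)) (lin_traj γ (dig β) 0) k (fun _ _ => rfl)
  simp only [shift_zero, h.period, lin, sub_zero] at e
  have h1 : 1 < γ ^ k := one_lt_pow₀ hg1 (by have := h.pos; omega)
  constructor
  · intro hev
    rw [hev.neg_pow] at e
    nlinarith
  · intro hev
    rw [(Nat.not_even_iff_odd.1 hev).neg_pow] at e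
    nlinarith

theorem lemQ {β : ℝ} {k : ℕ} (h : Per β k) : ∃ δ > 0, ∀ γ, |γ - β| < δ →
    (Even k ∧ lin γ (dig β) 0 k < 0 ∨ ¬ Even k ∧ 0 < lin γ (dig β) 0 k) →
    altLt (dig γ) (dig β) := by
  obtain ⟨δ, hδ, hδ1, H⟩ := block h
  obtain ⟨δ', hδ', H'⟩ := cc_small h hδ
  have hk := h.pos
  have hlast := h.last
  refine ⟨min δ δ', by positivity, fun γ hγ hs => ?_⟩
  have hγ1 := lt_of_lt_of_le hγ (min_le_left _ _)
  have hc := H' γ (lt_of_lt_of_le hγ (min_le_right _ _))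
  obtain ⟨hg1, B0, C0⟩ := H γ 0 hγ1 le_rfl hδ
  simp only [mul_zero, add_zero] at B0 C0
  have hCk : bC (dig β) k (k - 1) = dig β (k - 1) - 1 := by
    unfold bC; rw [if_pos (by omega)]
  have hCi : ∀ i < k - 1, bC (dig β) k i = dig β i := by
    intro i hi; unfold bC; rw [if_neg (by omega), if_neg (by omega)]
  rcases hs with ⟨hev, hs⟩ | ⟨hev, hs⟩
  · obtain ⟨C1', -⟩ := C0 hs
    have C1 : ∀ i < k + 1, dig γ i = bC (dig β) k i := C1'
    refine ⟨k - 1, fun i hi => by rw [C1 i (by omega), hCi i hi], ?_⟩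
    rw [if_neg, C1 (k - 1) (by omega), hCk]
    · omega
    · rw [Nat.even_sub hk]; simp [hev]
  · obtain ⟨B1, B2⟩ := B0 hs.le
    obtain ⟨-, -, C1⟩ := H γ _ hγ1 hs.le (lt_of_le_of_lt (le_abs_self _) hc)
    have hp : 1 < γ ^ k := one_lt_pow₀ hg1 (by omega)
    obtain ⟨C2, -⟩ := C1 (by rw [(Nat.not_even_iff_odd.1 hev).neg_pow]; nlinarith)
    have hper := h.period
    have hpi : ∀ i, dig β (k + i) = dig β i := fun i => congrFun hper i
    have hgi : ∀ i, dig γ (k + i) = dg γ (lin γ (dig β) 0 k) i := by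
      intro i; rw [dig, dg_add, B2]
    refine ⟨k + (k - 1), fun i hi => ?_, ?_⟩
    · by_cases hik : i < k
      · exact B1 i hik
      · obtain ⟨j, rfl⟩ := Nat.exists_eq_add_of_le (not_lt.1 hik)
        rw [hgi, hpi, C2 j (by omega), hCi j (by omega)]
    · rw [if_neg, hgi, hpi, C2 _ (by omega), hCk]
      · omega
      · rw [Nat.even_add, Nat.even_sub hk]; simp [hev]

theorem mono {β β' : ℝ} (hβ : 1 < β) (hlt : β < β') : altLt (dig β') (dig β) := by
  rcases per_or hβ with hn | ⟨k, hk⟩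
  · exact mono_nonper hβ hlt hn
  · obtain ⟨δ, hδ, H⟩ := lemQ hk
    obtain ⟨γ, h1, h2, hn⟩ := exists_nonper (a := β) (b := min β' (β + δ)) hβ.le
      (lt_min hlt (by linarith))
    have h3 := lt_of_lt_of_le h2 (min_le_left _ _)
    have h4 := lt_of_lt_of_le h2 (min_le_right _ _)
    have hs := sign_right hk h1
    have h5 : altLt (dig γ) (dig β) := by
      apply H γ (by rw [abs_lt]; constructor <;> linarith)
      by_cases hev : Even k
      · exact Or.inl ⟨hev, hs.1 hev⟩
      · exact Or.inr ⟨hev, hs.2 hev⟩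
    exact altLt_trans (mono_nonper (by linarith) h3 hn) h5

theorem sign_left {β : ℝ} {k : ℕ} (h : Per β k) : ∃ δ > 0, ∀ γ, |γ - β| < δ → γ < β →
    (Even k → 0 < lin γ (dig β) 0 k) ∧ (¬ Even k → lin γ (dig β) 0 k < 0) := by
  obtain ⟨δ, hδ, hδ1, H⟩ := block h
  obtain ⟨δ', hδ', H'⟩ := lemQ h
  have hk := h.pos
  refine ⟨min δ δ', by positivity, fun γ hγ hlt => ?_⟩
  obtain ⟨hg1, B0, -⟩ := H γ 0 (lt_of_lt_of_le hγ (min_le_left _ _)) le_rfl hδ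
  simp only [mul_zero, add_zero] at B0
  have hm := mono hg1 hlt
  have hQ : ¬ (Even k ∧ lin γ (dig β) 0 k < 0 ∨ ¬ Even k ∧ 0 < lin γ (dig β) 0 k) := fun hc =>
    altLt_asymm hm (H' γ (lt_of_lt_of_le hγ (min_le_right _ _)) hc)
  have hne : lin γ (dig β) 0 k ≠ 0 := by
    intro h0
    obtain ⟨B1, B2⟩ := B0 h0.ge
    rw [h0] at B2
    have hp := (orb_eq_zero_iff hg1 k).1 B2
    have hper := h.period
    have : dig γ = dig β := by
      funext i
      induction i using Nat.strong_induction_on with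
      | _ i ih =>
        by_cases hik : i < k
        · exact B1 i hik
        · obtain ⟨j, rfl⟩ := Nat.exists_eq_add_of_le (not_lt.1 hik)
          rw [show dig γ (k + j) = dig γ j from congrFun hp j,
            show dig β (k + j) = dig β j from congrFun hper j]
          exact ih j (by omega)
    rw [this] at hm
    exact altLt_irrefl _ hm
  constructor
  · intro hev
    by_contra hc
    exact hQ (Or.inl ⟨hev, lt_of_le_of_ne (not_lt.1 hc) hne⟩)
  · intro hev
    by_contra hc
    exact hQ (Or.inr ⟨hev, lt_of_le_of_ne (not_lt.1 hc) hne.symm⟩)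

/-! ### one-sided limits -/

def cat (w : ℕ → ℕ) (n : ℕ) (y : ℕ → ℕ) : ℕ → ℕ := fun i => if i < n then w i else y (i - n)

def perC (b : ℕ → ℕ) (k : ℕ) : ℕ → ℕ := fun i => bC b k (i % (k + 1))

def minS (b : ℕ → ℕ) (k : ℕ) : ℕ → ℕ :=
  if Even k then cat (bC b k) (k + 1) b else cat b k (perC b k)

def maxS (b : ℕ → ℕ) (k : ℕ) : ℕ → ℕ := if Even k then b else perC b k

theorem agree_blocks {γ δ c R : ℝ} {l : ℕ} {y : ℕ → ℕ} {P : ℝ → Prop} (hR : 1 ≤ R) (hc : 0 ≤ c)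
    (hy : ∀ i, y (l + i) = y i)
    (hstep : ∀ v, P v → 0 ≤ v → v < δ → (∀ i < l, dg γ v i = y i) ∧ P (orb γ v l) ∧
      0 ≤ orb γ v l ∧ orb γ v l + c ≤ R * (v + c)) (j : ℕ) :
    ∀ v, P v → 0 ≤ v → R ^ j * (v + c) < δ → ∀ i < l * j, dg γ v i = y i := by
  induction j with
  | zero => simp
  | succ j ih =>
    intro v hv h0 hlt i hi
    have h1 : v + c ≤ R ^ (j + 1) * (v + c) :=
      le_mul_of_one_le_left (by linarith) (one_le_pow₀ hR)
    obtain ⟨s1, s2, s3, s4⟩ := hstep v hv h0 (by linarith)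
    by_cases hil : i < l
    · exact s1 i hil
    · obtain ⟨m, rfl⟩ := Nat.exists_eq_add_of_le (not_lt.1 hil)
      rw [dg_add, hy]
      apply ih _ s2 s3
      · calc R ^ j * (orb γ v l + c) ≤ R ^ j * (R * (v + c)) := by gcongr
          _ = R ^ (j + 1) * (v + c) := by ring
          _ < δ := hlt
      · rw [mul_add, mul_one] at hi; omega

theorem perC_per (b : ℕ → ℕ) (k i : ℕ) : perC b k (k + 1 + i) = perC b k i := by
  unfold perC; rw [Nat.add_mod_left]

theorem perC_lt (b : ℕ → ℕ) {k i : ℕ} (h : i < k + 1) : perC b k i = bC b k i := by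
  unfold perC; rw [Nat.mod_eq_of_lt h]

/-- data common to all limits -/
theorem limit_data {β : ℝ} {k : ℕ} (h : Per β k) (N : ℕ) : ∃ R δ δ' : ℝ, 1 ≤ R ∧ 0 < δ ∧ 0 < δ' ∧
    ∀ γ, |γ - β| < δ' → 1 < γ ∧ R ^ (N + 1) * |lin γ (dig β) 0 k| < δ ∧
      |lin γ (dig β) 0 k| + |lin γ (dig β) 0 k| ≤ R * |lin γ (dig β) 0 k| ∧
      γ * |lin γ (dig β) 0 k| + |lin γ (dig β) 0 k| ≤ R * |lin γ (dig β) 0 k| ∧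
      (∀ v, 0 ≤ v → |lin γ (dig β) 0 k| + γ ^ k * v + |lin γ (dig β) 0 k|
          ≤ R * (v + |lin γ (dig β) 0 k|)) ∧
      (∀ v, 0 ≤ v → γ * (|lin γ (dig β) 0 k| + γ ^ k * v) + |lin γ (dig β) 0 k|
          ≤ R * (v + |lin γ (dig β) 0 k|)) ∧
      ∀ v, 0 ≤ v → v < δ →
      (0 ≤ lin γ (dig β) 0 k + (-γ) ^ k * v → (∀ i < k, dg γ v i = dig β i) ∧
        orb γ v k = lin γ (dig β) 0 k + (-γ) ^ k * v) ∧
      (lin γ (dig β) 0 k + (-γ) ^ k * v < 0 → (∀ i < k + 1, dg γ v i = bC (dig β) k i) ∧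
        orb γ v (k + 1) = -γ * (lin γ (dig β) 0 k + (-γ) ^ k * v)) := by
  obtain ⟨δ, hδ, hδ1, H⟩ := block h
  have hβ := h.one
  set R : ℝ := (β + 1) ^ (k + 1) + 1 with hR
  have hp1 : 1 ≤ (β + 1) ^ (k + 1) := one_le_pow₀ (by linarith)
  have hR1 : 1 ≤ R := by linarith
  obtain ⟨δ', hδ', H'⟩ := cc_small h (ε := δ / R ^ (N + 1)) (by positivity)
  refine ⟨R, δ, min δ δ', hR1, hδ, by positivity, fun γ hγ => ?_⟩
  have hγ1 := lt_of_lt_of_le hγ (min_le_left _ _)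
  have hc := H' γ (lt_of_lt_of_le hγ (min_le_right _ _))
  have hg := (H γ 0 hγ1 le_rfl hδ).1
  have hgb : γ ≤ β + 1 := by
    have := (abs_lt.1 hγ1).2; linarith
  set c := |lin γ (dig β) 0 k| with hcd
  have hc0 : 0 ≤ c := abs_nonneg _
  have hgk : γ ^ (k + 1) ≤ (β + 1) ^ (k + 1) := pow_le_pow_left₀ (by linarith) hgb _
  have hgk1 : γ ^ k ≤ γ ^ (k + 1) := pow_le_pow_right₀ hg.le (by omega)
  have hg1 : γ ≤ γ ^ (k + 1) := by
    simpa using pow_le_pow_right₀ hg.le (show 1 ≤ k + 1 by omega)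
  have hγγ : γ * γ ^ k = γ ^ (k + 1) := by ring
  refine ⟨hg, ?_, ?_, ?_, ?_, ?_, fun v h0 h1 => (H γ v hγ1 h0 h1).2⟩
  · rw [lt_div_iff₀ (by positivity)] at hc; linarith
  · nlinarith
  · nlinarith
  · intro v hv; nlinarith [mul_le_mul_of_nonneg_right (hgk1.trans hgk) hv]
  · intro v hv
    have := mul_le_mul_of_nonneg_right hgk hv
    have e : γ * (c + γ ^ k * v) = γ * c + γ ^ (k+1) * v := by rw [← hγγ]; ring
    rw [e]
    nlinarith [mul_le_mul_of_nonneg_right (hg1.trans hgk) hc0]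

theorem left_limit {β : ℝ} {k : ℕ} (h : Per β k) (N : ℕ) : ∃ δ > 0, ∀ γ, |γ - β| < δ → γ < β →
    ∀ i < N, dig γ i = maxS (dig β) k i := by
  obtain ⟨R, δ, δ', hR, hδ, hδ', H⟩ := limit_data h N
  obtain ⟨δ'', hδ'', HS⟩ := sign_left h
  have hk := h.pos
  refine ⟨min δ' δ'', by positivity, fun γ hγ hlt => ?_⟩
  obtain ⟨hg, H1, H2, H3, H4, H5, HB⟩ := H γ (lt_of_lt_of_le hγ (min_le_left _ _))
  have hs := HS γ (lt_of_lt_of_le hγ (min_le_right _ _)) hlt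
  set c := lin γ (dig β) 0 k with hc
  have hfit : R ^ N * (0 + |c|) < δ := by
    have : R ^ N * |c| ≤ R ^ (N + 1) * |c| := by
      apply mul_le_mul_of_nonneg_right _ (abs_nonneg _)
      exact pow_le_pow_right₀ hR (by omega)
    rw [zero_add]; linarith
  have hgp : 0 < γ ^ k := by positivity
  unfold maxS
  by_cases hev : Even k
  · rw [if_pos hev]
    have hs := hs.1 hev
    have hN : N ≤ k * N := Nat.le_mul_of_pos_left N hk
    have := agree_blocks (γ := γ) (δ := δ) (c := |c|) (R := R) (l := k) (y := dig β)
      (P := fun _ => True) hR (abs_nonneg _) (fun i => congrFun h.period i) (by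
        intro v _ h0 h1
        have hb := (HB v h0 h1).1
        rw [hev.neg_pow] at hb
        have hnn : 0 ≤ c + γ ^ k * v := by positivity
        obtain ⟨b1, b2⟩ := hb hnn
        refine ⟨b1, trivial, by rw [b2]; exact hnn, ?_⟩
        rw [b2]
        have := H4 v h0
        rw [abs_of_pos hs] at this ⊢
        exact this) N 0 trivial le_rfl hfit
    exact fun i hi => this i (by omega)
  · rw [if_neg hev]
    have hs := hs.2 hev
    have hN : N ≤ (k + 1) * N := Nat.le_mul_of_pos_left N (by omega)
    have := agree_blocks (γ := γ) (δ := δ) (c := |c|) (R := R) (l := k + 1) (y := perC (dig β) k)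
      (P := fun _ => True) hR (abs_nonneg _) (perC_per _ k) (by
        intro v _ h0 h1
        have hb := (HB v h0 h1).2
        rw [(Nat.not_even_iff_odd.1 hev).neg_pow] at hb
        have hnn : c + -γ ^ k * v < 0 := by nlinarith [mul_nonneg hgp.le h0]
        obtain ⟨b1, b2⟩ := hb hnn
        refine ⟨fun i hi => by rw [b1 i hi, perC_lt _ hi], trivial, by rw [b2]; nlinarith, ?_⟩
        rw [b2]
        have := H5 v h0
        rw [abs_of_neg hs] at this ⊢
        linarith) N 0 trivial le_rfl hfit
    exact fun i hi => this i (by omega)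

theorem pow_ineq_mono {β γ : ℝ} {k : ℕ} (hβ : 1 < β) (hk : 1 ≤ k) (hlt : β ≤ γ)
    (hP : β + 1 ≤ β ^ (k + 1)) : γ + 1 ≤ γ ^ (k + 1) := by
  have h1 : β ^ k ≤ γ ^ k := pow_le_pow_left₀ (by linarith) hlt k
  have h2 : 1 < β ^ k := one_lt_pow₀ hβ (by omega)
  rw [pow_succ] at *
  nlinarith

theorem right_limit {β : ℝ} {k : ℕ} (h : Per β k) (hP : β + 1 ≤ β ^ (k + 1)) (N : ℕ) :
    ∃ δ > 0, ∀ γ, |γ - β| < δ → β < γ → ∀ i < N, dig γ i = minS (dig β) k i := by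
  obtain ⟨R, δ, δ', hR, hδ, hδ', H⟩ := limit_data h N
  have hk := h.pos
  refine ⟨δ', hδ', fun γ hγ hlt => ?_⟩
  obtain ⟨hg, H1, H2, H3, H4, H5, HB⟩ := H γ hγ
  have hs := sign_right h hlt
  have hPg := pow_ineq_mono h.one hk hlt.le hP
  set c := lin γ (dig β) 0 k with hc
  have hgp : 0 < γ ^ k := by positivity
  have hgp1 : 1 < γ ^ k := one_lt_pow₀ hg (by omega)
  have hγγ : γ * γ ^ k = γ ^ (k + 1) := by ring
  have hRN : ∀ v, v + |c| ≤ R * |c| → R ^ N * (v + |c|) < δ := by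
    intro v hv
    have : R ^ N * (v + |c|) ≤ R ^ N * (R * |c|) := by
      apply mul_le_mul_of_nonneg_left hv; positivity
    calc _ ≤ _ := this
      _ = R ^ (N + 1) * |c| := by ring
      _ < δ := H1
  unfold minS
  by_cases hev : Even k
  · rw [if_pos hev]
    have hs := hs.1 hev
    have hb := (HB 0 le_rfl hδ).2
    rw [mul_zero, add_zero] at hb
    obtain ⟨b1, b2⟩ := hb hs
    have hN : N ≤ k * N := Nat.le_mul_of_pos_left N hk
    have := agree_blocks (γ := γ) (δ := δ) (c := |c|) (R := R) (l := k) (y := dig β)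
      (P := fun v => v ≤ c + γ ^ k * v) hR (abs_nonneg _) (fun i => congrFun h.period i) (by
        intro v hv h0 h1
        have hb := (HB v h0 h1).1
        rw [hev.neg_pow] at hb
        have hnn : 0 ≤ c + γ ^ k * v := by linarith
        obtain ⟨b1, b2⟩ := hb hnn
        refine ⟨b1, ?_, by rw [b2]; exact hnn, ?_⟩
        · rw [b2]; nlinarith
        · rw [b2]
          have := H4 v h0
          rw [abs_of_neg hs] at this ⊢
          linarith) N (-γ * c) (by nlinarith) (by nlinarith)
          (hRN _ (by rw [abs_of_neg hs] at H3 ⊢; linarith))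
    intro i hi
    unfold cat
    by_cases hik : i < k + 1
    · rw [if_pos hik]; exact b1 i hik
    · rw [if_neg hik]
      obtain ⟨m, rfl⟩ := Nat.exists_eq_add_of_le (not_lt.1 hik)
      rw [dig, dg_add, b2, Nat.add_sub_cancel_left]
      exact this m (by omega)
  · rw [if_neg hev]
    have hs := hs.2 hev
    have hb := (HB 0 le_rfl hδ).1
    rw [mul_zero, add_zero] at hb
    obtain ⟨b1, b2⟩ := hb hs.le
    have hN : N ≤ (k + 1) * N := Nat.le_mul_of_pos_left N (by omega)
    have := agree_blocks (γ := γ) (δ := δ) (c := |c|) (R := R) (l := k + 1) (y := perC (dig β) k)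
      (P := fun v => 0 < v ∧ v ≤ γ * (γ ^ k * v - c)) hR (abs_nonneg _) (perC_per _ k) (by
        intro v hv h0 h1
        have hb := (HB v h0 h1).2
        rw [(Nat.not_even_iff_odd.1 hev).neg_pow] at hb
        have hnn : c + -γ ^ k * v < 0 := by
          by_contra hcc
          have : γ ^ k * v - c ≤ 0 := by linarith
          nlinarith [hv.1, hv.2]
        obtain ⟨b1, b2⟩ := hb hnn
        have b3 : orb γ v (k + 1) = γ * (γ ^ k * v - c) := by rw [b2]; ring
        refine ⟨fun i hi => by rw [b1 i hi, perC_lt _ hi], ⟨by rw [b3]; linarith [hv.1, hv.2], ?_⟩,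
          by rw [b3]; linarith [hv.1, hv.2], ?_⟩
        · rw [b3]
          apply mul_le_mul_of_nonneg_left _ (by linarith)
          have := mul_le_mul_of_nonneg_left hv.2 hgp.le
          linarith
        · rw [b3]
          have := H5 v h0
          rw [abs_of_pos hs] at this ⊢
          nlinarith) N c ⟨hs, by nlinarith⟩ hs.le
          (hRN _ (by rw [abs_of_pos hs] at H2 ⊢; linarith))
    intro i hi
    unfold cat
    by_cases hik : i < k
    · rw [if_pos hik]; exact b1 i hik
    · rw [if_neg hik]
      obtain ⟨m, rfl⟩ := Nat.exists_eq_add_of_le (not_lt.1 hik)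
      rw [dig, dg_add, b2, Nat.add_sub_cancel_left]
      exact this m (by omega)

end NB



namespace NB

/-! ### the substitution -/

theorem phiW_append (a b : List ℕ) : phiW (a ++ b) = phiW a ++ phiW b := by
  simp [phiW]

theorem phiW_iter_append (n : ℕ) (a b : List ℕ) :
    phiW^[n] (a ++ b) = phiW^[n] a ++ phiW^[n] b := by
  induction n generalizing a b with
  | zero => rfl
  | succ n ih => rw [Function.iterate_succ_apply, phiW_append, ih]; rfl

theorem uW_rec (n : ℕ) : uW (n + 2) = uW (n + 1) ++ uW n ++ uW n := by
  have h0 : ∀ n, phiW^[n + 1] [0] = uW n := by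
    intro n
    rw [Function.iterate_succ_apply]; rfl
  unfold uW
  rw [Function.iterate_succ_apply]
  have : phiW [1] = [1] ++ [0] ++ [0] := by decide
  rw [this, phiW_iter_append, phiW_iter_append, h0]; rfl

def kk : ℕ → ℕ
  | 0 => 1
  | 1 => 3
  | n + 2 => kk (n + 1) + 2 * kk n

theorem uW_zero : uW 0 = [1] := rfl
theorem uW_one : uW 1 = [1, 0, 0] := by decide

theorem uW_len : ∀ n, (uW n).length = kk n
  | 0 => rfl
  | 1 => by rw [uW_one]; rfl
  | n + 2 => by
    rw [uW_rec, List.length_append, List.length_append, uW_len (n + 1), uW_len n, kk]; ring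

theorem kk_pos : ∀ n, 1 ≤ kk n
  | 0 => le_rfl
  | 1 => by decide
  | n + 2 => by rw [kk]; have := kk_pos (n + 1); omega

theorem kk_lt (n : ℕ) : kk n < kk (n + 1) := by
  cases n with
  | zero => decide
  | succ n => rw [kk]; have := kk_pos n; omega

theorem kk_ge (n : ℕ) : n + 1 ≤ kk n := by
  induction n with
  | zero => exact le_rfl
  | succ n ih => have := kk_lt n; omega

theorem kk_odd : ∀ n, Odd (kk n)
  | 0 => by decide
  | 1 => by decide
  | n + 2 => by rw [kk]; exact (kk_odd (n + 1)).add_even (even_two_mul _)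

theorem uW_pre (n : ℕ) : uW n <+: uW (n + 1) := by
  cases n with
  | zero => rw [uW_zero, uW_one]; decide
  | succ n => rw [uW_rec, List.append_assoc]; exact List.prefix_append _ _

theorem uW_preLe {m n : ℕ} (h : m ≤ n) : uW m <+: uW n := by
  induction n, h using Nat.le_induction with
  | base => exact List.prefix_rfl
  | succ n _ ih => exact ih.trans (uW_pre n)

theorem getD_pre {a b : List ℕ} (h : a <+: b) {i : ℕ} (hi : i < a.length) :
    a.getD i 0 = b.getD i 0 := by
  obtain ⟨c, rfl⟩ := h
  rw [List.getD_append _ _ _ _ hi]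

theorem phiInf_eq {n i : ℕ} (hi : i < kk n) : (uW n).getD i 0 = phiInf i := by
  unfold phiInf
  have h2 : i < (uW (i + 1)).length := by rw [uW_len]; have := kk_ge (i + 1); omega
  have h1 : i < (uW n).length := by rw [uW_len]; exact hi
  rcases le_total n (i + 1) with h | h
  · exact getD_pre (uW_preLe h) h1
  · exact (getD_pre (uW_preLe h) h2).symm

/-! ### the renormalisation -/

noncomputable def pp (β : ℝ) : ℕ → ℝ
  | 0 => β - 1
  | 1 => β * (β - 1) ^ 2
  | n + 2 => β ^ (2 * kk n) * pp β (n + 1) - (β ^ kk n - 1) * pp β n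

theorem pp_inv (β : ℝ) (hβ : 1 < β) : ∀ n, pp β (n + 1) * β ^ (2 * kk n)
    = pp β n * (β ^ kk n - 1) * β ^ kk (n + 1)
  | 0 => by simp only [pp, kk]; ring
  | n + 1 => by
    have ih := pp_inv β hβ n
    have h0 : β ^ kk (n + 1) ≠ 0 := by positivity
    rw [pp, kk, pow_add, show 2 * kk (n + 1) = kk (n + 1) + kk (n + 1) by ring, pow_add]
    linear_combination (β ^ kk (n+1)) * ih

theorem pp_pos (β : ℝ) (hβ : 1 < β) : ∀ n, 0 < pp β n
  | 0 => by simp only [pp]; linarith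
  | n + 1 => by
    have h1 := pp_inv β hβ n
    have h2 := pp_pos β hβ n
    have h3 : 1 < β ^ kk n := one_lt_pow₀ hβ (by have := kk_pos n; omega)
    have h4 : 0 < pp β n * (β ^ kk n - 1) * β ^ kk (n + 1) := by
      apply mul_pos (mul_pos h2 (by linarith)); positivity
    rw [← h1] at h4
    exact pos_of_mul_pos_left h4 (by positivity)

def CC (β : ℝ) (n : ℕ) : Prop := (β ^ kk n - 1) * β ^ kk (n + 1) < β ^ kk n

theorem CC_iff {β : ℝ} (hβ : 1 < β) {n : ℕ} (h : CC β n) : pp β (n + 1) * β ^ kk n < pp β n := by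
  have h1 := pp_inv β hβ n
  have h2 := pp_pos β hβ n
  have h3 : 0 < β ^ kk n := by positivity
  unfold CC at h
  rw [show 2 * kk n = kk n + kk n by ring, pow_add] at h1
  have h4 := mul_lt_mul_of_pos_left h h2
  have h5 : pp β (n + 1) * β ^ kk n * β ^ kk n < pp β n * β ^ kk n := by linarith
  exact lt_of_mul_lt_mul_right h5 h3.le

def Valid (β : ℝ) (n : ℕ) : Prop := ∀ u, 0 ≤ u → β ^ kk n * u < pp β n → u < 1 →
  (∀ i < kk n, dg β u i = (uW n).getD i 0) ∧ (∀ j, 1 ≤ j → j ≤ kk n → 0 < orb β u j) ∧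
  orb β u (kk n) = pp β n - β ^ kk n * u

theorem valid_zero {β : ℝ} (hg : β ^ 2 < β + 1) : Valid β 0 := by
  intro u h0 h1 hu
  simp only [kk, pow_one, pp] at h1 ⊢
  have hb2 : β < 2 := by nlinarith
  have hbu : 0 ≤ β ∨ β < 0 := le_or_gt 0 β
  have hb0 : 0 < β := by
    rcases hbu with h | h
    · rcases eq_or_lt_of_le h with h' | h'
      · subst h'; simp at h1; linarith
      · exact h'
    · nlinarith
  obtain ⟨a, b⟩ := dg_step (β := β) (u := u) (n := 0) (e := 1) (v := u) rfl
    (by push_cast; linarith) (by push_cast; nlinarith)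
  push_cast at b
  refine ⟨?_, ?_, by rw [b]; ring⟩
  · intro i hi
    have : i = 0 := by omega
    subst this; rw [a]; rfl
  · intro j hj hj'
    have : j = 1 := by omega
    subst this; rw [b]; linarith

theorem valid_one {β : ℝ} (hβ : 1 < β) (hg : β ^ 2 < β + 1) : Valid β 1 := by
  intro u h0 h1 hu
  simp only [kk, pp] at h1 ⊢
  have hb2 : β < 2 := by nlinarith
  have hbu : 0 ≤ β * u := by positivity
  have hb2u : 0 ≤ β ^ 2 * u := by positivity
  have hlt : β ^ 2 * u < (β - 1) ^ 2 := by
    have : β * (β ^ 2 * u) < β * (β - 1) ^ 2 := by linarith [show β * (β ^ 2 * u) = β ^ 3 * u by ring]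
    exact lt_of_mul_lt_mul_left this (by linarith)
  have hlt2 : β * u < β - 1 := by nlinarith
  obtain ⟨a1, b1⟩ := dg_step (β := β) (u := u) (n := 0) (e := 1) (v := u) rfl
    (by push_cast; linarith) (by push_cast; nlinarith)
  push_cast at b1
  obtain ⟨a2, b2⟩ := dg_step (β := β) (u := u) (n := 1) (e := 0) b1
    (by push_cast; nlinarith) (by push_cast; nlinarith)
  push_cast at b2
  have b2' : orb β u 2 = β * (2 - β) + β ^ 2 * u := by
    show orb β u (1 + 1) = _
    rw [b2]; ring
  have e3 : β * (1 - (β * (2 - β) + β ^ 2 * u)) = β * (β - 1) ^ 2 - β ^ 3 * u := by ring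
  have hq : β * (β - 1) ^ 2 < 1 := by nlinarith
  have hb3u : 0 ≤ β ^ 3 * u := by positivity
  obtain ⟨a3, b3⟩ := dg_step (β := β) (u := u) (n := 2) (e := 0) b2'
    (by rw [e3]; push_cast; linarith) (by rw [e3]; push_cast; linarith)
  rw [e3] at b3
  push_cast at b3
  have b3' : orb β u 3 = β * (β - 1) ^ 2 - β ^ 3 * u := by
    show orb β u (2 + 1) = _
    rw [b3]; ring
  refine ⟨?_, ?_, b3'⟩
  · intro i hi
    rw [uW_one]
    interval_cases i
    · exact a1
    · exact a2
    · exact a3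
  · intro j hj hj'
    interval_cases j
    · rw [b1]; nlinarith
    · rw [b2']; nlinarith
    · rw [b3']; linarith

theorem valid_step {β : ℝ} (hβ : 1 < β) {n : ℕ} (hc : CC β n) (h0 : Valid β n)
    (h1 : Valid β (n + 1)) : Valid β (n + 2) := by
  intro u hu0 hu hu1
  set k := kk (n + 1) with hk
  set m := kk n with hm
  have hkk : kk (n + 2) = k + (m + m) := by rw [kk]; ring
  have hC := CC_iff hβ hc
  have hq := pp_pos β hβ n
  have hp := pp_pos β hβ (n + 1)
  set p := pp β (n + 1) with hpd
  set q := pp β n with hqd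
  have hpp : pp β (n + 2) = β ^ m * β ^ m * p - (β ^ m - 1) * q := by
    rw [pp, ← pow_add, ← two_mul]
  set K := β ^ k with hK
  set B := β ^ m with hB
  have hB1 : 1 < B := one_lt_pow₀ hβ (by have := kk_pos n; omega)
  have hK1 : 1 < K := one_lt_pow₀ hβ (by have := kk_pos (n+1); omega)
  rw [hpp, hkk, pow_add, pow_add, ← hK, ← hB] at hu
  rw [hpp, hkk, pow_add, pow_add, ← hK, ← hB]
  -- u' , u''
  have hu'' : B * (q - B * (p - K * u)) < q := by nlinarith
  have hu''0 : 0 < q - B * (p - K * u) := by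
    have : 0 ≤ B * (K * u) := by positivity
    nlinarith
  have hu' : 0 < p - K * u := by
    by_contra hcc
    push Not at hcc
    have h2 : q ≤ q - B * (p - K * u) := by nlinarith
    nlinarith
  obtain ⟨x1, y1, z1⟩ := h1 u hu0 (by linarith) hu1
  have hKu : 0 ≤ K * u := by positivity
  have lt1 : ∀ j, 1 ≤ j → orb β u j < 1 := by
    intro j hj
    obtain ⟨i, rfl⟩ : ∃ i, j = i + 1 := ⟨j - 1, by omega⟩
    exact (T_mem _ _).2
  have hk1 : 1 ≤ k := kk_pos (n + 1)
  have hm1 : 1 ≤ m := kk_pos n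
  rw [← hpd, ← hk, ← hK] at z1
  have l1 := lt1 k hk1
  rw [z1] at l1
  obtain ⟨x2, y2, z2⟩ := h0 (p - K * u) hu'.le (by nlinarith) l1
  rw [← hqd, ← hm, ← hB] at z2
  have z2' : orb β u (k + m) = q - B * (p - K * u) := by rw [orb_add, z1, z2]
  have l2 := lt1 (k + m) (by omega)
  rw [z2'] at l2
  obtain ⟨x3, y3, z3⟩ := h0 _ hu''0.le hu'' l2
  rw [← hqd, ← hm, ← hB] at z3
  have z3' : orb β u (k + m + m) = q - B * (q - B * (p - K * u)) := by rw [orb_add, z2', z3]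
  refine ⟨?_, ?_, by rw [← add_assoc, z3']; ring⟩
  · intro i hi
    rw [uW_rec]
    have l1 : (uW (n + 1)).length = k := uW_len _
    have l2 : (uW n).length = m := uW_len _
    by_cases c1 : i < k
    · rw [List.append_assoc, List.getD_append _ _ _ _ (by omega)]; exact x1 i c1
    · obtain ⟨i, rfl⟩ := Nat.exists_eq_add_of_le (not_lt.1 c1)
      rw [List.append_assoc, List.getD_append_right _ _ _ _ (by omega), l1,
        Nat.add_sub_cancel_left, dg_add, z1]
      by_cases c2 : i < m
      · rw [List.getD_append _ _ _ _ (by omega)]; exact x2 i c2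
      · obtain ⟨i, rfl⟩ := Nat.exists_eq_add_of_le (not_lt.1 c2)
        rw [List.getD_append_right _ _ _ _ (by omega), l2, Nat.add_sub_cancel_left, dg_add, z2]
        exact x3 i (by omega)
  · intro j hj hj'
    by_cases c1 : j ≤ k
    · exact y1 j hj c1
    · obtain ⟨j, rfl⟩ := Nat.exists_eq_add_of_le (not_le.1 c1).le
      rw [orb_add, z1]
      by_cases c2 : j ≤ m
      · exact y2 j (by omega) c2
      · obtain ⟨j, rfl⟩ := Nat.exists_eq_add_of_le (not_le.1 c2).le
        rw [orb_add, z2]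
        exact y3 j (by omega) (by omega)

theorem valid_all {β : ℝ} (hβ : 1 < β) (hg : β ^ 2 < β + 1) (n : ℕ) (hc : ∀ j < n, CC β j) :
    Valid β n ∧ Valid β (n + 1) := by
  induction n with
  | zero => exact ⟨valid_zero hg, valid_one hβ hg⟩
  | succ n ih =>
    obtain ⟨h0, h1⟩ := ih (fun j hj => hc j (by omega))
    exact ⟨h1, valid_step hβ (hc n (by omega)) h0 h1⟩

theorem valid_dig {β : ℝ} (hβ : 1 < β) {n : ℕ} (h : Valid β n) :
    (∀ i < kk n, dig β i = phiInf i) ∧ ∀ j, 1 ≤ j → j ≤ kk n → orb β 0 j ≠ 0 := by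
  obtain ⟨h1, h2, -⟩ := h 0 le_rfl (by rw [mul_zero]; exact pp_pos β hβ n) one_pos
  exact ⟨fun i hi => (h1 i hi).trans (phiInf_eq hi), fun j hj hj' => (h2 j hj hj').ne'⟩

theorem lemR {β : ℝ} (hβ : 1 < β) (hg : β ^ 2 < β + 1) : ∃ K, 1 ≤ K ∧ 2 ≤ β ^ K ∧
    (∀ i < K, dig β i = phiInf i) ∧ ∀ j, 1 ≤ j → j ≤ K → orb β 0 j ≠ 0 := by
  classical
  have hex : ∃ n, ¬ CC β n := by
    obtain ⟨n, hn⟩ := pow_unbounded_of_one_lt 2 hβ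
    refine ⟨n, ?_⟩
    have h1 : 2 < β ^ kk n :=
      lt_of_lt_of_le hn (pow_le_pow_right₀ hβ.le (by have := kk_ge n; omega))
    have h2 : β ^ kk n ≤ β ^ kk (n + 1) := pow_le_pow_right₀ hβ.le (kk_lt n).le
    unfold CC
    rw [not_lt]
    nlinarith
  set n := Nat.find hex with hn
  have hmin : ∀ j < n, CC β j := fun j hj => by
    by_contra hc; exact Nat.find_min hex hj hc
  have hnn : ¬ CC β n := Nat.find_spec hex
  obtain ⟨h1, h2⟩ := valid_dig hβ (valid_all hβ hg n hmin).2
  refine ⟨kk (n + 1), kk_pos _, ?_, h1, h2⟩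
  have h2 : β ^ kk n ≤ β ^ kk (n + 1) := pow_le_pow_right₀ hβ.le (kk_lt n).le
  have h3 : 1 < β ^ kk n := one_lt_pow₀ hβ (by have := kk_pos n; omega)
  unfold CC at hnn
  rw [not_lt] at hnn
  by_contra hc
  push Not at hc
  nlinarith

theorem near_one (N : ℕ) : ∃ ε > 0, ∀ β : ℝ, 1 < β → β < 1 + ε → ∀ i < N, dig β i = phiInf i := by
  have e1 : ∀ j ∈ Finset.range N, ∀ᶠ β : ℝ in 𝓝 1, CC β j := by
    intro j _
    have c1 : Continuous (fun β : ℝ => (β ^ kk j - 1) * β ^ kk (j + 1)) := by fun_prop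
    have c2 : Continuous (fun β : ℝ => β ^ kk j) := by fun_prop
    exact c1.continuousAt.eventually_lt c2.continuousAt (by simp)
  have e2 : ∀ᶠ β : ℝ in 𝓝 1, β ^ 2 < β + 1 := by
    have c1 : Continuous (fun β : ℝ => β ^ 2) := by fun_prop
    have c2 : Continuous (fun β : ℝ => β + 1) := by fun_prop
    exact c1.continuousAt.eventually_lt c2.continuousAt (by norm_num)
  have e3 := ((Filter.eventually_all_finset (Finset.range N)).2 e1).and e2
  rw [Metric.eventually_nhds_iff] at e3
  obtain ⟨ε, hε, H⟩ := e3
  refine ⟨ε, hε, fun β h1 h2 => ?_⟩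
  obtain ⟨H1, H2⟩ := H (y := β) (by rw [Real.dist_eq, abs_lt]; constructor <;> linarith)
  have hv := (valid_all h1 H2 N (fun j hj => H1 j (Finset.mem_range.2 hj))).1
  intro i hi
  exact (valid_dig h1 hv).1 i (by have := kk_ge N; omega)

theorem lemP {β : ℝ} {k : ℕ} (h : Per β k) : β + 1 ≤ β ^ (k + 1) := by
  have hβ := h.one
  by_cases hg : β ^ 2 < β + 1
  · obtain ⟨K, hK1, hK2, -, hK3⟩ := lemR hβ hg
    have hkK : K < k := by
      by_contra hc
      exact hK3 k h.pos (not_lt.1 hc) h.zero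
    have : β ^ K * β ≤ β ^ (k + 1) := by
      rw [← pow_succ]; exact pow_le_pow_right₀ hβ.le (by omega)
    nlinarith
  · have : β ^ 2 ≤ β ^ (k + 1) := pow_le_pow_right₀ hβ.le (by have := h.pos; omega)
    linarith

theorem dig_lt_phi {β : ℝ} (hβ : 1 < β) : altLt (dig β) phiInf := by
  by_contra hc
  rw [not_altLt] at hc
  obtain ⟨γ, hγ1, hγ2⟩ := exists_between hβ
  have h1 := altLe_lt hc (mono hγ1 hγ2)
  obtain ⟨N, hN⟩ := altLt_agree_left h1
  obtain ⟨ε, hε, H⟩ := near_one N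
  obtain ⟨γ', h2, h3⟩ := exists_between (show 1 < min γ (1 + ε) from lt_min hγ1 (by linarith))
  have h4 := hN (dig γ') (H γ' h2 (lt_of_lt_of_le h3 (min_le_right _ _)))
  exact altLt_asymm h4 (mono h2 (lt_of_lt_of_le h3 (min_le_left _ _)))

end NB

namespace NB

theorem le_at {x y : ℕ → ℕ} {n : ℕ} (h : altLe x y) (ha : ∀ i < n, x i = y i) :
    if Even n then y n ≤ x n else x n ≤ y n := by
  rcases h with rfl | ⟨k, hk, hk'⟩
  · split_ifs <;> exact le_rfl
  · rcases lt_trichotomy n k with h | h | h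
    · rw [hk n h]; split_ifs <;> exact le_rfl
    · subst h; split_ifs at hk' ⊢ <;> exact hk'.le
    · have := ha k h
      split_ifs at hk' <;> omega

theorem sandwich {x z y : ℕ → ℕ} {n : ℕ} (h1 : altLe x z) (h2 : altLe z y)
    (h : ∀ i < n, x i = y i) : ∀ i < n, z i = x i := by
  intro i
  induction i using Nat.strong_induction_on with
  | _ i ih =>
    intro hi
    have a := le_at h1 (n := i) (fun j hj => (ih j hj (by omega)).symm)
    have b := le_at h2 (n := i) (fun j hj => (ih j hj (by omega)).trans (h j (by omega)))
    have := h i hi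
    split_ifs at a b <;> omega

theorem lim_le {y d : ℕ → ℕ} (h : ∀ N, ∃ x : ℕ → ℕ, (∀ i < N, x i = y i) ∧ altLe x d) :
    altLe y d := by
  by_contra hc
  rw [not_altLe] at hc
  obtain ⟨N, hN⟩ := altLt_agree_right hc
  obtain ⟨x, hx, hx'⟩ := h N
  exact altLt_irrefl _ (altLt_le (hN x hx) hx')

theorem le_lim {y d : ℕ → ℕ} (h : ∀ N, ∃ x : ℕ → ℕ, (∀ i < N, x i = y i) ∧ altLe d x) :
    altLe d y := by
  by_contra hc
  rw [not_altLe] at hc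
  obtain ⟨N, hN⟩ := altLt_agree_left hc
  obtain ⟨x, hx, hx'⟩ := h N
  exact altLt_irrefl _ (altLt_le (hN x hx) hx')

section lists
variable {a : List ℕ}

theorem ps_getD {i : ℕ} (hi : i < a.length) : periodicSeq a i = a.getD i 0 := by
  simp only [periodicSeq, Nat.mod_eq_of_lt hi]

theorem ps_per (a : List ℕ) (i : ℕ) : periodicSeq a (a.length + i) = periodicSeq a i := by
  simp [periodicSeq]

theorem ml_len (ha : 1 ≤ a.length) : (modList a).length = a.length + 1 := by
  simp [modList]; omega

theorem ml_getD (ha : 1 ≤ a.length) {i : ℕ} (hi : i < a.length + 1) :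
    (modList a).getD i 0 = bC (periodicSeq a) a.length i := by
  unfold modList bC
  have hl : (a.take (a.length - 1)).length = a.length - 1 := by simp
  rcases lt_trichotomy (i + 1) a.length with h | h | h
  · rw [List.getD_append _ _ _ _ (by omega), if_neg (by omega), if_neg (by omega),
      ps_getD (by omega)]
    simp only [List.getD_eq_getElem?_getD]
    rw [List.getElem?_take_of_lt (by omega)]
  · rw [List.getD_append_right _ _ _ _ (by omega), hl, if_pos h, ps_getD (by omega),
      show i - (a.length - 1) = 0 by omega, show a.length - 1 = i by omega]
    rfl
  · rw [List.getD_append_right _ _ _ _ (by omega), hl, if_neg (by omega), if_pos (by omega),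
      show i - (a.length - 1) = 1 by omega]
    rfl

theorem ps_ml (ha : 1 ≤ a.length) : periodicSeq (modList a) = perC (periodicSeq a) a.length := by
  funext i
  unfold perC
  rw [← ml_getD ha (Nat.mod_lt _ (by omega)), periodicSeq, ml_len ha]

theorem pp_ml (ha : 1 ≤ a.length) :
    prefixPeriodic (modList a) a = cat (bC (periodicSeq a) a.length) (a.length + 1) (periodicSeq a) := by
  funext i
  unfold prefixPeriodic cat
  rw [ml_len ha]
  split_ifs with h
  · exact ml_getD ha h
  · rfl

theorem pp_ml' (ha : 1 ≤ a.length) :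
    prefixPeriodic a (modList a) = cat (periodicSeq a) a.length (perC (periodicSeq a) a.length) := by
  funext i
  rw [← ps_ml ha]
  unfold prefixPeriodic cat
  split_ifs with h
  · exact (ps_getD h).symm
  · rfl

theorem lyn_cond (ha : 1 ≤ a.length) (d : ℕ → ℕ) :
    (if Even a.length
      then altLe (prefixPeriodic (modList a) a) d ∧ altLe d (periodicSeq a) ∧
        altLt (periodicSeq a) phiInf
      else altLe (prefixPeriodic a (modList a)) d ∧ altLe d (periodicSeq (modList a)) ∧
        altLt (periodicSeq (modList a)) phiInf) ↔
    (altLe (minS (periodicSeq a) a.length) d ∧ altLe d (maxS (periodicSeq a) a.length) ∧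
      altLt (maxS (periodicSeq a) a.length) phiInf) := by
  rw [pp_ml ha, pp_ml' ha, ps_ml ha, minS, maxS]
  split_ifs <;> rfl

end lists

theorem ps_range {b : ℕ → ℕ} {k : ℕ} (hk : 1 ≤ k) (hb : shiftSeq b k = b) :
    periodicSeq ((List.range k).map b) = b := by
  funext i
  have h2 : ∀ q j, b (k * q + j) = b j := by
    intro q
    induction q with
    | zero => intro j; simp
    | succ q ih =>
      intro j
      rw [mul_add, mul_one, add_assoc, ih]
      exact congrFun hb j
  have hm : i % k < k := Nat.mod_lt _ (by omega)
  have h3 : periodicSeq ((List.range k).map b) i = b (i % k) := by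
    simp [periodicSeq, List.getD_eq_getElem?_getD, List.getElem?_range hm]
  rw [h3, ← h2 (i / k) (i % k), Nat.div_add_mod]

/-- The backward direction. -/
theorem backward {d : ℕ → ℕ} (hl : IsAltLyndon d) (hb : d ∉ LynSet) (hc : altLt d phiInf) :
    ∃ β : ℝ, 1 < β ∧ d = dig β := by
  set S : Set ℝ := {γ | 1 < γ ∧ altLe d (dig γ)} with hS
  obtain ⟨γ0, hγ0⟩ : S.Nonempty := by
    obtain ⟨N, hN⟩ := altLt_agree_right hc
    obtain ⟨ε, hε, h⟩ := near_one N
    exact ⟨1 + ε / 2, by linarith, Or.inr (hN _ (h _ (by linarith) (by linarith)))⟩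
  have hbd : BddAbove S := by
    refine ⟨d 0 + 1, fun γ hγ => ?_⟩
    have h := le_at hγ.2 (n := 0) (by simp)
    simp only [Even.zero, if_true] at h
    have h' : dig γ 0 = ⌊γ⌋₊ := by simp [dig, dg, orb]
    rw [h'] at h
    have h1 := Nat.lt_floor_add_one γ
    have h2 : (⌊γ⌋₊ : ℝ) ≤ d 0 := by exact_mod_cast h
    linarith
  set β := sSup S with hβdef
  have hβ : 1 < β := lt_of_lt_of_le hγ0.1 (le_csSup hbd hγ0)
  have hright : ∀ γ, β < γ → altLt (dig γ) d := by
    intro γ hγ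
    by_contra hh
    rw [not_altLt] at hh
    have : γ ≤ β := le_csSup hbd ⟨by linarith, hh⟩
    linarith
  have hleft : ∀ γ, 1 < γ → γ < β → altLt d (dig γ) := by
    intro γ h1 hγ
    obtain ⟨γ', hγ', h2⟩ := exists_lt_of_lt_csSup ⟨γ0, hγ0⟩ hγ
    exact altLe_lt hγ'.2 (mono h1 h2)
  have gr : ∀ δ > 0, ∃ γ, |γ - β| < δ ∧ β < γ := fun δ hδ =>
    ⟨β + δ / 2, by rw [add_sub_cancel_left, abs_of_pos (by linarith)]; linarith, by linarith⟩
  have gl : ∀ δ > 0, ∃ γ, |γ - β| < δ ∧ γ < β ∧ 1 < γ := by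
    intro δ hδ
    have hm : 0 < min (δ / 2) ((β - 1) / 2) := lt_min (by linarith) (by linarith)
    refine ⟨β - min (δ / 2) ((β - 1) / 2), ?_, by linarith, ?_⟩
    · rw [sub_sub_cancel_left, abs_neg, abs_of_pos hm]
      linarith [min_le_left (δ / 2) ((β - 1) / 2)]
    · linarith [min_le_right (δ / 2) ((β - 1) / 2)]
  refine ⟨β, hβ, ?_⟩
  rcases per_or hβ with hn | ⟨k, hk⟩
  · apply altLe_antisymm
    · refine le_lim fun N => ?_
      obtain ⟨δ, hδ, h⟩ := agree_nonper hβ hn N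
      obtain ⟨γ, h1, h2, h3⟩ := gl δ hδ
      exact ⟨dig γ, h γ h1, Or.inr (hleft γ h3 h2)⟩
    · refine lim_le fun N => ?_
      obtain ⟨δ, hδ, h⟩ := agree_nonper hβ hn N
      obtain ⟨γ, h1, h2⟩ := gr δ hδ
      exact ⟨dig γ, h γ h1, Or.inr (hright γ h2)⟩
  · by_contra hne
    have hmin : altLe (minS (dig β) k) d := by
      refine lim_le fun N => ?_
      obtain ⟨δ, hδ, h⟩ := right_limit hk (lemP hk) N
      obtain ⟨γ, h1, h2⟩ := gr δ hδ
      exact ⟨dig γ, h γ h1 h2, Or.inr (hright γ h2)⟩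
    have hmax : altLe d (maxS (dig β) k) := by
      refine le_lim fun N => ?_
      obtain ⟨δ, hδ, h⟩ := left_limit hk N
      obtain ⟨γ, h1, h2, h3⟩ := gl δ hδ
      exact ⟨dig γ, h γ h1 h2, Or.inr (hleft γ h3 h2)⟩
    have hphi : altLt (maxS (dig β) k) phiInf := by
      obtain ⟨γ0, _, hγ1, hγ2⟩ := gl 1 one_pos
      refine altLe_lt (y := dig γ0) (lim_le fun N => ?_) (dig_lt_phi hγ2)
      obtain ⟨δ, hδ, h⟩ := left_limit hk N
      obtain ⟨γ, h1, h2, h3⟩ := gl (min δ (β - γ0)) (lt_min hδ (by linarith))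
      refine ⟨dig γ, h γ (lt_of_lt_of_le h1 (min_le_left _ _)) h2, Or.inr (mono hγ2 ?_)⟩
      have := lt_of_lt_of_le h1 (min_le_right _ _)
      rw [abs_lt] at this
      linarith
    apply hb
    have hps := ps_range hk.pos hk.period
    set a := (List.range k).map (dig β) with ha
    have hal : a.length = k := by simp [ha]
    have ha1 : 1 ≤ a.length := by rw [hal]; exact hk.pos
    refine ⟨hl, a, ha1, ?_, ?_, ?_, ?_, ?_⟩
    · rw [← ps_getD (by omega), hps, hal]
      have := hk.last
      omega
    · rw [hps]; exact dig_lyndon hβ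
    · intro m h1 h2 h3
      rw [hps] at h3
      rw [hal] at h2
      apply hk.min m h1 h2
      rw [orb_eq_zero_iff hβ]
      funext i
      rw [← h3 i, add_comm]; rfl
    · rw [hps]; exact hne
    · rw [lyn_cond ha1, hps, hal]
      exact ⟨hmin, hmax, hphi⟩

end NB

namespace NB

theorem val_A {β v : ℝ} {b : ℕ → ℕ} {k : ℕ} (hβ : 1 < β) (h0 : 0 ≤ v) (h1 : v < 1)
    (h : ∀ i < k, dg β v i = b i) : orb β v k = lin β b 0 k + (-β) ^ k * v := by
  have := traj_agree (traj_orb (by linarith) h0 h1) (lin_traj β b v) k h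
  rw [← lin_affine]
  simp only [orb, lin] at this
  linarith

theorem val_B {β v : ℝ} {b : ℕ → ℕ} {k : ℕ} (hβ : 1 < β) (h0 : 0 ≤ v) (h1 : v < 1) (hk : 1 ≤ k)
    (hb : 1 ≤ b (k - 1)) (h : ∀ i < k + 1, dg β v i = bC b k i) :
    orb β v k = lin β b 0 k + (-β) ^ k * v + 1 ∧
    orb β v (k + 1) = -β * (lin β b 0 k + (-β) ^ k * v) := by
  obtain ⟨j, rfl⟩ : ∃ j, k = j + 1 := ⟨k - 1, by omega⟩
  simp only [Nat.add_sub_cancel] at hb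
  have e1 := val_A (b := b) (k := j) hβ h0 h1 (fun i hi => by
    rw [h i (by omega), bC, if_neg (by omega), if_neg (by omega)])
  have e2 := orb_succ (β := β) (by linarith) h0 h1 j
  have e3 := orb_succ (β := β) (by linarith) h0 h1 (j + 1)
  have d1 : dg β v j = b j - 1 := by rw [h j (by omega), bC, if_pos rfl]
  have d2 : dg β v (j + 1) = 0 := by rw [h (j + 1) (by omega), bC, if_neg (by omega), if_pos rfl]
  have e4 : lin β b 0 (j + 1) + (-β) ^ (j + 1) * v = β * (1 - orb β v j) - b j := by
    rw [← lin_affine, lin, lin_affine, ← e1]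
  rw [d1, Nat.cast_sub hb] at e2
  rw [d2] at e3
  push_cast at e2 e3
  rw [e4]
  constructor
  · linarith
  · rw [e3, e2]; ring

theorem agree_bC {x b : ℕ → ℕ} {k : ℕ} (hk : 1 ≤ k) (h : ∀ i < k - 1, x i = b i)
    (h1 : x (k - 1) = b (k - 1) - 1) (h2 : x k = 0) : ∀ i < k + 1, x i = bC b k i := by
  intro i hi
  unfold bC
  split_ifs with c1 c2
  · rw [show i = k - 1 by omega, h1]
  · rw [c2, h2]
  · exact h i (by omega)

theorem unbdd {β e η : ℝ} (hη : 0 < η) (h : ∀ j : ℕ, ∃ v, 0 ≤ v ∧ v < 1 ∧ e + j * η ≤ v) :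
    False := by
  obtain ⟨j, hj⟩ := exists_nat_gt ((1 - e) / η)
  obtain ⟨v, _, h1, h2⟩ := h j
  rw [div_lt_iff₀ hη] at hj
  linarith

/-- If a Lyndon word agrees with a larger periodic word on a full period, they are equal. -/
theorem eq_of_block {d M : ℕ → ℕ} {l : ℕ} (hd : IsAltLyndon d) (hl : 1 ≤ l) (hle : altLe d M)
    (hM : shiftSeq M l = M) (hz : altLe (shiftSeq d l) M) (ha : ∀ i < l, d i = M i) : d = M := by
  by_contra hne
  obtain ⟨n, hn, hn'⟩ := first_diff hne
  have hln : l ≤ n := by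
    by_contra hh
    exact hn' (ha n (by omega))
  have h1 := sandwich (hd l) hz hn (n - l) (by omega)
  have h2 : shiftSeq d l (n - l) = d n := by simp only [shiftSeq]; congr 1; omega
  have h3 : M n = M (n - l) := by
    conv_rhs => rw [← hM]
    simp only [shiftSeq]; congr 1; omega
  rw [h2, hn (n - l) (by omega)] at h1
  exact hn' (h1.trans h3.symm)

theorem perC_shift (b : ℕ → ℕ) (k : ℕ) : shiftSeq (perC b k) (k + 1) = perC b k := by
  funext i; exact perC_per b k i

/-- One step of the block decomposition, odd case. -/
theorem odd_step {β v : ℝ} {b : ℕ → ℕ} {k : ℕ} (hβ : 1 < β) (hk : 1 ≤ k) (hodd : ¬ Even k)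
    (hb : 1 ≤ b (k - 1)) (hdb : ∀ i < k, dig β i = b i) (h0 : 0 ≤ v) (h1 : v < 1)
    (hM : altLe (dg β v) (perC b k)) (hc : lin β b 0 k < β ^ k * v) :
    altLe (dg β (orb β v (k + 1))) (perC b k) ∧
      orb β v (k + 1) = β * (β ^ k * v - lin β b 0 k) := by
  have hpow : (-β) ^ k = - β ^ k := Odd.neg_pow (Nat.not_even_iff_odd.1 hodd) β
  have hdv : altLe (dig β) (dg β v) := altLe_of_le hβ le_rfl one_pos h0 h1 h0
  have hpb : ∀ i < k - 1, perC b k i = b i := fun i hi => by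
    rw [perC_lt b (by omega), bC, if_neg (by omega), if_neg (by omega)]
  have hag : ∀ i < k - 1, dg β v i = b i := fun i hi => by
    rw [sandwich hdv hM (n := k - 1) (fun i hi => by rw [hdb i (by omega), hpb i hi]) i hi,
      hdb i (by omega)]
  have hev : Even (k - 1) := by
    rcases Nat.even_or_odd (k - 1) with h | h
    · exact h
    · exact absurd (by have := h.add_one; rwa [Nat.sub_add_cancel hk] at this) hodd
  have l1 := le_at hdv (n := k - 1) (fun i hi => by rw [hdb i (by omega), hag i hi])
  have l2 := le_at hM (n := k - 1) (fun i hi => by rw [hag i hi, hpb i hi])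
  rw [if_pos hev] at l1 l2
  have hp1 : perC b k (k - 1) = b (k - 1) - 1 := by
    rw [perC_lt b (by omega), bC, if_pos (by omega)]
  rw [hp1] at l2
  rw [hdb _ (by omega)] at l1
  have hne : dg β v (k - 1) ≠ b (k - 1) := by
    intro he
    have := val_A (b := b) (k := k) hβ h0 h1 (fun i hi => by
      rcases Nat.lt_or_ge i (k - 1) with h | h
      · exact hag i h
      · rw [show i = k - 1 by omega, he])
    have h2 := (orb_mem (β := β) h0 h1 k).1
    rw [this, hpow] at h2
    linarith
  have heq : dg β v (k - 1) = b (k - 1) - 1 := by omega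
  have l3 := le_at hM (n := k) (fun i hi => by
      rcases Nat.lt_or_ge i (k - 1) with h | h
      · rw [hag i h, hpb i h]
      · rw [show i = k - 1 by omega, heq, hp1])
  rw [if_neg hodd, perC_lt b (by omega), bC, if_neg (by omega), if_pos rfl] at l3
  have hall := agree_bC hk hag heq (by omega)
  constructor
  · rw [← dg_shift]
    rw [altLe_shift_even (m := k + 1) (fun i hi => by rw [hall i hi, perC_lt b hi])
      (by rw [Nat.even_add_one]; exact hodd), perC_shift] at hM
    exact hM
  · rw [(val_B hβ h0 h1 hk hb hall).2, hpow]; ring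

/-- One step of the block decomposition, even case. -/
theorem even_step {β v : ℝ} {b : ℕ → ℕ} {k : ℕ} (hβ : 1 < β) (hk : 1 ≤ k) (heven : Even k)
    (hb : 1 ≤ b (k - 1)) (hbp : shiftSeq b k = b) (hdb : ∀ i < k + 1, dig β i = bC b k i)
    (h0 : 0 ≤ v) (h1 : v < 1)
    (hM : altLe (dg β v) b) (hc : 0 ≤ lin β b 0 k + β ^ k * v) :
    altLe (dg β (orb β v k)) b ∧ orb β v k = lin β b 0 k + β ^ k * v := by
  have hpow : (-β) ^ k = β ^ k := heven.neg_pow β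
  have hdv : altLe (dig β) (dg β v) := altLe_of_le hβ le_rfl one_pos h0 h1 h0
  have hpb : ∀ i < k - 1, dig β i = b i := fun i hi => by
    rw [hdb i (by omega), bC, if_neg (by omega), if_neg (by omega)]
  have hag : ∀ i < k - 1, dg β v i = b i := fun i hi => by
    rw [sandwich hdv hM (n := k - 1) hpb i hi, hpb i hi]
  have hev : ¬ Even (k - 1) := by
    intro h
    have := h.add_one
    rw [Nat.sub_add_cancel hk] at this
    exact Nat.not_even_iff_odd.2 this heven
  have l1 := le_at hdv (n := k - 1) (fun i hi => by rw [hpb i (by omega), hag i hi])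
  have l2 := le_at hM (n := k - 1) hag
  rw [if_neg hev] at l1 l2
  have hp1 : dig β (k - 1) = b (k - 1) - 1 := by
    rw [hdb _ (by omega), bC, if_pos (by omega)]
  rw [hp1] at l1
  have hne : dg β v (k - 1) ≠ b (k - 1) - 1 := by
    intro he
    have l3 := le_at hdv (n := k) (fun i hi => by
      rcases Nat.lt_or_ge i (k - 1) with h | h
      · rw [hag i h, hpb i h]
      · rw [show i = k - 1 by omega, he, hp1])
    rw [if_pos heven, hdb k (by omega), bC, if_neg (by omega), if_pos rfl] at l3
    have := (val_B hβ h0 h1 hk hb (agree_bC hk hag he (by omega))).1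
    have h2 := (orb_mem (β := β) h0 h1 k).2
    rw [this, hpow] at h2
    linarith
  have hall : ∀ i < k, dg β v i = b i := fun i hi => by
      rcases Nat.lt_or_ge i (k - 1) with h | h
      · exact hag i h
      · rw [show i = k - 1 by omega]; omega
  constructor
  · rw [← dg_shift]
    rw [altLe_shift_even hall heven, hbp] at hM
    exact hM
  · rw [val_A hβ h0 h1 hall, hpow]

theorem eta {β : ℝ} {b : ℕ → ℕ} {k : ℕ} (hβ : 1 < β) (hk : 1 ≤ k) (hb : 1 ≤ b (k - 1))
    (hphi : altLt (maxS b k) phiInf) (hag : ∀ i < k - 1, dig β i = b i)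
    (he : Even k → dig β (k - 1) = b (k - 1) - 1) (ho : ¬ Even k → dig β (k - 1) = b (k - 1)) :
    β + 1 < β ^ (k + 1) := by
  by_cases hg : β ^ 2 < β + 1
  · obtain ⟨K, hK1, hK2, hK3, _⟩ := lemR hβ hg
    by_cases hkK : K ≤ k
    · have : β ^ K ≤ β ^ k := pow_le_pow_right₀ hβ.le hkK
      rw [pow_succ]
      nlinarith
    · exfalso
      apply altLt_asymm hphi
      have hmb : ∀ i < k - 1, maxS b k i = b i := by
        intro i hi
        unfold maxS
        split_ifs
        · rfl
        · rw [perC_lt b (by omega), bC, if_neg (by omega), if_neg (by omega)]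
      refine ⟨k - 1, fun i hi => ?_, ?_⟩
      · rw [← hK3 i (by omega), hag i hi, hmb i hi]
      · rw [← hK3 (k - 1) (by omega)]
        by_cases h : Even k
        · have hev : ¬ Even (k - 1) := by
            intro h'
            have := h'.add_one
            rw [Nat.sub_add_cancel hk] at this
            exact Nat.not_even_iff_odd.2 this h
          rw [if_neg hev, he h, maxS, if_pos h]
          omega
        · have hev : Even (k - 1) := by
            rcases Nat.even_or_odd (k - 1) with h' | h'
            · exact h'
            · exact absurd (by have := h'.add_one; rwa [Nat.sub_add_cancel hk] at this) h
          rw [if_pos hev, ho h, maxS, if_neg h, perC_lt b (by omega), bC, if_pos (by omega)]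
          omega
  · rw [not_lt] at hg
    rcases Nat.lt_or_ge k 2 with h | h
    · have : k = 1 := by omega
      subst this
      have ho' := ho (by decide)
      simp only [Nat.sub_self] at ho' hb
      have hb2 : 2 ≤ b 0 := by
        by_contra hh
        have hb1 : b 0 = 1 := by omega
        have := le_at (n := 0) (Or.inr hphi) (by simp)
        rw [if_pos (by decide), maxS, if_neg (by decide), perC_lt b (by omega), bC, if_pos rfl, hb1,
          show phiInf 0 = 1 by decide] at this
        omega
      have h' : dig β 0 = ⌊β⌋₊ := by simp [dig, dg, orb]
      have : (2 : ℝ) ≤ β := by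
        have h2 : 2 ≤ ⌊β⌋₊ := by omega
        have h3 : ((2 : ℕ) : ℝ) ≤ ⌊β⌋₊ := by exact_mod_cast h2
        have := Nat.floor_le (by linarith : 0 ≤ β)
        push_cast at h3
        linarith
      norm_num
      nlinarith
    · have : β ^ 3 ≤ β ^ (k + 1) := pow_le_pow_right₀ hβ.le (by omega)
      nlinarith

theorem not_lyn {β : ℝ} {b : ℕ → ℕ} {k : ℕ} (hβ : 1 < β) (hk : 1 ≤ k) (hb : 1 ≤ b (k - 1))
    (hbp : shiftSeq b k = b) (hne : dig β ≠ b) (hmin : altLe (minS b k) (dig β))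
    (hmax : altLe (dig β) (maxS b k)) (hphi : altLt (maxS b k) phiInf) : False := by
  have hd := dig_lyndon hβ
  by_cases hev : Even k
  · rw [minS, if_pos hev] at hmin
    have hphi' := hphi
    rw [maxS, if_pos hev] at hmax hphi'
    have hcb : ∀ i < k + 1, cat (bC b k) (k + 1) b i = bC b k i := fun i hi => by
      rw [cat, if_pos hi]
    have hcb' : ∀ i < k - 1, cat (bC b k) (k + 1) b i = b i := fun i hi => by
      rw [hcb i (by omega), bC, if_neg (by omega), if_neg (by omega)]
    have hag : ∀ i < k - 1, dig β i = b i := fun i hi => by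
      rw [sandwich hmin hmax hcb' i hi, hcb' i hi]
    have hev' : ¬ Even (k - 1) := by
      intro h'
      have := h'.add_one
      rw [Nat.sub_add_cancel hk] at this
      exact Nat.not_even_iff_odd.2 this hev
    have l1 := le_at hmin (n := k - 1) (fun i hi => by rw [hcb' i hi, hag i hi])
    have l2 := le_at hmax (n := k - 1) hag
    rw [if_neg hev'] at l1 l2
    rw [hcb _ (by omega), bC, if_pos (by omega)] at l1
    have hne' : dig β (k - 1) ≠ b (k - 1) := by
      intro he
      have hall : ∀ i < k, dig β i = b i := fun i hi => by
        rcases Nat.lt_or_ge i (k - 1) with h | h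
        · exact hag i h
        · rw [show i = k - 1 by omega, he]
      refine hne (eq_of_block hd hk hmax hbp ?_ hall)
      rw [altLe_shift_even hall hev, hbp] at hmax
      exact hmax
    have heq : dig β (k - 1) = b (k - 1) - 1 := by omega
    have l3 := le_at hmin (n := k) (fun i hi => by
      rcases Nat.lt_or_ge i (k - 1) with h | h
      · rw [hag i h, hcb' i h]
      · rw [show i = k - 1 by omega, heq, hcb _ (by omega), bC, if_pos (by omega)])
    rw [if_pos hev, hcb k (by omega), bC, if_neg (by omega), if_pos rfl] at l3
    have hall := agree_bC hk hag heq (by omega)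
    have hη := eta hβ hk hb hphi hag (fun _ => heq) (fun h => absurd hev h)
    have hv := val_B hβ le_rfl one_pos hk hb hall
    simp only [mul_zero, add_zero] at hv
    set c := lin β b 0 k with hcdef
    have hm := (orb_mem (β := β) le_rfl one_pos k).2
    have hc : c < 0 := by linarith [hv.1]
    have hz : altLe (dg β (orb β 0 (k + 1))) b := by
      rw [altLe_shift_odd (m := k + 1) (fun i hi => by rw [hcb i hi, hall i hi])
        (by rw [Nat.even_add_one]; exact fun h => h hev)] at hmin
      rw [← dg_shift]
      convert hmin using 1
      funext i
      simp [shiftSeq, cat]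
      omega
    have hbk : 1 < β ^ k := one_lt_pow₀ hβ (by omega)
    have key : ∀ j : ℕ, ∃ v, 0 ≤ v ∧ v < 1 ∧ altLe (dg β v) b ∧
        -c * β + j * (-c * (β ^ (k + 1) - β - 1)) ≤ v := by
      intro j
      induction j with
      | zero =>
        obtain ⟨m0, m1⟩ := orb_mem (β := β) le_rfl one_pos (k + 1)
        exact ⟨_, m0, m1, hz, by rw [hv.2]; simp; linarith⟩
      | succ j ih =>
        obtain ⟨v, v0, v1, vb, hv'⟩ := ih
        have hj : 0 ≤ (j : ℝ) * (-c * (β ^ (k + 1) - β - 1)) :=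
          mul_nonneg (Nat.cast_nonneg _) (mul_nonneg (by linarith) (by linarith))
        have hvc : -c * β ≤ v := by linarith
        have h2 : (β ^ k - 1) * (-c * β) ≤ (β ^ k - 1) * v :=
          mul_le_mul_of_nonneg_left hvc (by linarith)
        have h3 : -c * (β ^ (k + 1) - β - 1) = (β ^ k - 1) * (-c * β) + c := by ring
        have h4 : v + -c * (β ^ (k + 1) - β - 1) ≤ c + β ^ k * v := by linarith
        have h5 : 0 ≤ -c * (β ^ (k + 1) - β - 1) := mul_nonneg (by linarith) (by linarith)
        obtain ⟨s1, s2⟩ := even_step hβ hk hev hb hbp hall v0 v1 vb (by linarith)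
        obtain ⟨m0, m1⟩ := orb_mem (β := β) v0 v1 k
        refine ⟨_, m0, m1, s1, ?_⟩
        rw [s2]
        push_cast
        linarith
    exact unbdd (β := β) (mul_pos (neg_pos.2 hc) (by linarith : 0 < β ^ (k + 1) - β - 1))
      (fun j => by obtain ⟨v, a1, a2, _, a3⟩ := key j; exact ⟨v, a1, a2, a3⟩)
  · rw [minS, if_neg hev] at hmin
    rw [maxS, if_neg hev] at hmax
    have hpow : (-β) ^ k = - β ^ k := Odd.neg_pow (Nat.not_even_iff_odd.1 hev) β
    have hcb : ∀ i < k, cat b k (perC b k) i = b i := fun i hi => by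
      rw [cat, if_pos hi]
    have hpb : ∀ i < k - 1, perC b k i = b i := fun i hi => by
      rw [perC_lt b (by omega), bC, if_neg (by omega), if_neg (by omega)]
    have hag : ∀ i < k - 1, dig β i = b i := fun i hi => by
      rw [sandwich hmin hmax (n := k - 1)
        (fun i hi => by rw [hcb i (by omega), hpb i hi]) i hi, hcb i (by omega)]
    have hev' : Even (k - 1) := by
      rcases Nat.even_or_odd (k - 1) with h' | h'
      · exact h'
      · exact absurd (by have := h'.add_one; rwa [Nat.sub_add_cancel hk] at this) hev
    have l1 := le_at hmin (n := k - 1) (fun i hi => by rw [hcb i (by omega), hag i hi])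
    have l2 := le_at hmax (n := k - 1) (fun i hi => by rw [hpb i hi, hag i hi])
    rw [if_pos hev'] at l1 l2
    have hp1 : perC b k (k - 1) = b (k - 1) - 1 := by
      rw [perC_lt b (by omega), bC, if_pos (by omega)]
    rw [hcb _ (by omega)] at l1
    rw [hp1] at l2
    by_cases hcase : dig β (k - 1) = b (k - 1)
    · have hall : ∀ i < k, dig β i = b i := fun i hi => by
        rcases Nat.lt_or_ge i (k - 1) with h | h
        · exact hag i h
        · rw [show i = k - 1 by omega, hcase]
      have hη := eta hβ hk hb hphi hag (fun h => absurd h hev) (fun _ => hcase)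
      have hv := val_A hβ le_rfl one_pos hall
      simp only [mul_zero, add_zero] at hv
      set c := lin β b 0 k with hcdef
      obtain ⟨m0, m1⟩ := orb_mem (β := β) le_rfl one_pos k
      have hc : 0 < c := by
        rcases eq_or_lt_of_le m0 with h | h
        · exfalso
          apply hne
          have hs := (orb_eq_zero_iff hβ k).1 h.symm
          rw [← ps_range hk hs, ← ps_range hk hbp]
          congr 1
          apply List.map_congr_left
          intro i hi
          exact hall i (List.mem_range.1 hi)
        · linarith
      have hz : altLe (dg β (orb β 0 k)) (perC b k) := by
        rw [altLe_shift_odd (m := k) (fun i hi => by rw [hcb i hi, hall i hi]) hev] at hmin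
        rw [← dg_shift]
        convert hmin using 1
        funext i
        simp [shiftSeq, cat]
      have hbk : 1 < β ^ k := one_lt_pow₀ hβ (by omega)
      have key : ∀ j : ℕ, ∃ v, 0 ≤ v ∧ v < 1 ∧ altLe (dg β v) (perC b k) ∧
          c + j * (c * (β ^ (k + 1) - β - 1)) ≤ v := by
        intro j
        induction j with
        | zero => exact ⟨_, m0, m1, hz, by rw [hv]; simp⟩
        | succ j ih =>
          obtain ⟨v, v0, v1, vb, hv'⟩ := ih
          have h5 : 0 ≤ c * (β ^ (k + 1) - β - 1) := mul_nonneg (by linarith) (by linarith)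
          have hj : 0 ≤ (j : ℝ) * (c * (β ^ (k + 1) - β - 1)) :=
            mul_nonneg (Nat.cast_nonneg _) h5
          have hvc : c ≤ v := by linarith
          obtain ⟨s1, s2⟩ := odd_step hβ hk hev hb hall v0 v1 vb (by nlinarith)
          obtain ⟨m0, m1⟩ := orb_mem (β := β) v0 v1 (k + 1)
          refine ⟨_, m0, m1, s1, ?_⟩
          have h2 : (β ^ (k + 1) - 1) * c ≤ (β ^ (k + 1) - 1) * v :=
            mul_le_mul_of_nonneg_left hvc (by linarith)
          have h3 : β * (β ^ k * v - c) = β ^ (k + 1) * v - β * c := by ring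
          rw [s2, h3]
          push_cast
          linarith
      exact unbdd (β := β) (mul_pos hc (by linarith : 0 < β ^ (k + 1) - β - 1))
        (fun j => by obtain ⟨v, a1, a2, _, a3⟩ := key j; exact ⟨v, a1, a2, a3⟩)
    · have heq : dig β (k - 1) = b (k - 1) - 1 := by omega
      have l3 := le_at hmax (n := k) (fun i hi => by
        rcases Nat.lt_or_ge i (k - 1) with h | h
        · rw [hag i h, hpb i h]
        · rw [show i = k - 1 by omega, heq, hp1])
      rw [if_neg hev, perC_lt b (by omega), bC, if_neg (by omega), if_pos rfl] at l3
      have hall := agree_bC hk hag heq (by omega)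
      have hall' : ∀ i < k + 1, dig β i = perC b k i := fun i hi => by
        rw [hall i hi, perC_lt b hi]
      have hM : dig β = perC b k := by
        refine eq_of_block hd (by omega) hmax (perC_shift b k) ?_ hall'
        have := hmax
        rw [altLe_shift_even hall' (by rw [Nat.even_add_one]; exact hev), perC_shift] at this
        exact this
      have hv := val_B hβ le_rfl one_pos hk hb hall
      have hs : shiftSeq (dig β) (k + 1) = dig β := by rw [hM]; exact perC_shift b k
      rw [← orb_eq_zero_iff hβ] at hs
      have hm := (orb_mem (β := β) le_rfl one_pos k).2
      simp only [mul_zero, add_zero] at hv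
      have : lin β b 0 k = 0 := by
        have h := hv.2
        rw [hs] at h
        rcases mul_eq_zero.1 h.symm with h | h
        · linarith
        · exact h
      linarith [hv.1]

/-- The upper bound in condition (a). -/
theorem upper {β : ℝ} (hβ : 1 < β) (n : ℕ) :
    altLt (shiftSeq (dig β) n) (dstarShift (dig β)) := by
  set d := dig β with hd
  by_cases h0 : d n = 0
  swap
  · refine ⟨0, by simp, ?_⟩
    simp only [Even.zero, if_true, dstarShift, shiftSeq, add_zero]
    omega
  have hpos : 0 < orb β 0 (n + 1) := by
    rw [orb_succ (by linarith) le_rfl one_pos n, show dg β 0 n = 0 from h0]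
    have := (orb_mem (β := β) le_rfl one_pos n).2
    push_cast
    nlinarith
  have hlt1 := (orb_mem (β := β) le_rfl one_pos (n + 1)).2
  rw [altLt_shift (m := 1) (fun i hi => by
    have : i = 0 := by omega
    subst this; simp [shiftSeq, dstarShift, h0]), if_neg (by decide), shift_shift]
  have e1 : shiftSeq (dstarShift d) 1 = dstarOf d := by
    funext i; simp [shiftSeq, dstarShift]
  rw [e1, show shiftSeq d (n + 1) = dg β (orb β 0 (n + 1)) from dg_shift β 0 (n + 1)]
  by_cases hp : ∃ p, MinOddPeriodAt d p
  swap
  · have : dstarOf d = d := by simp only [dstarOf]; rw [dif_neg hp]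
    rw [this]
    exact altLt_of_lt hβ le_rfl one_pos hpos.le hlt1 hpos
  have hds : dstarOf d = periodicSeq ((List.range (2 * hp.choose)).map d ++ [d (2 * hp.choose) - 1, 0]) := by
    simp only [dstarOf]; rw [dif_pos hp]
  have hmp := hp.choose_spec
  set p := hp.choose with hpdef
  set k := 2 * p + 1 with hk
  have hper : Per β k := by
    refine ⟨hβ, by omega, ?_, ?_⟩
    · rw [orb_eq_zero_iff hβ]
      funext i
      rw [shiftSeq, add_comm]; exact hmp.1 i
    · intro j h1 h2 h3
      rw [orb_eq_zero_iff hβ] at h3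
      refine hmp.2 j h1 h2 fun i => ?_
      rw [add_comm]; exact congrFun h3 i
  have hps := ps_range hper.pos hper.period
  have hodd : ¬ Even k := by rw [hk, Nat.even_add_one]; simp
  have hM : dstarOf d = perC d k := by
    have hl : ((List.range k).map (dig β)).length = k := by simp
    have := ps_ml (a := (List.range k).map (dig β)) (by rw [hl]; omega)
    rw [hps, hl] at this
    rw [hds, ← this]
    congr 1
    unfold modList
    rw [hl]
    have t1 : k - 1 = 2 * p := by omega
    rw [t1, ← List.map_take, List.take_range, show min (2 * p) k = 2 * p by omega]
    congr 2
    simp [List.getD_eq_getElem?_getD, List.getElem?_range (show 2 * p < k by omega), hd]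
  rw [hM]
  by_contra hcon
  rw [not_altLt] at hcon
  have hlin : lin β d 0 k = 0 := by rw [hd, lin_dig hβ]; exact hper.zero
  set v1 := orb β 0 (n + 1) with hv1
  have hbk : 1 < β ^ (k + 1) := one_lt_pow₀ hβ (by omega)
  have key : ∀ j : ℕ, ∃ v, 0 ≤ v ∧ v < 1 ∧ altLe (dg β v) (perC d k) ∧
      v1 + j * (v1 * (β ^ (k + 1) - 1)) ≤ v := by
    intro j
    induction j with
    | zero => exact ⟨v1, hpos.le, hlt1, hcon, by simp⟩
    | succ j ih =>
      obtain ⟨v, a0, a1, vb, hv'⟩ := ih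
      have h5 : 0 ≤ v1 * (β ^ (k + 1) - 1) := mul_nonneg hpos.le (by linarith)
      have hj : 0 ≤ (j : ℝ) * (v1 * (β ^ (k + 1) - 1)) := mul_nonneg (Nat.cast_nonneg _) h5
      have hvc : v1 ≤ v := by linarith
      have hv0 : 0 < v := by linarith
      obtain ⟨s1, s2⟩ := odd_step (b := d) hβ hper.pos hodd hper.last (fun i _ => rfl) a0 a1 vb
        (by rw [hlin]; positivity)
      obtain ⟨m0, m1⟩ := orb_mem (β := β) a0 a1 (k + 1)
      refine ⟨_, m0, m1, s1, ?_⟩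
      have h2 : (β ^ (k + 1) - 1) * v1 ≤ (β ^ (k + 1) - 1) * v :=
        mul_le_mul_of_nonneg_left hvc (by linarith)
      have h3 : β * (β ^ k * v - 0) = β ^ (k + 1) * v := by ring
      rw [s2, hlin, h3]
      push_cast
      linarith
  exact unbdd (β := β) (mul_pos hpos (by linarith : 0 < β ^ (k + 1) - 1))
    (fun j => by obtain ⟨v, a1, a2, _, a3⟩ := key j; exact ⟨v, a1, a2, a3⟩)

end NB

/-- Theorem 3: `(d_i)` is the `(−β)`-expansion of `−β/(β+1)` for some `β > 1` iff
(a) `(d_i) ⪯ (d_{n+i−1}) ≺ (d*_{i−1})` for all `n ≥ 1` (where `d*_0 = 0`),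
(b) `(d_i) ∉ Lyn`, and (c) `(d_i) ≺ φ^∞(1)`.
Digits: `d_i = ⌊−β T_{−β}^{i−1}(l_β) − l_β⌋` with `l_β = −β/(β+1)`. -/
theorem stmt19 (d : ℕ → ℕ) (hbound : ∃ N : ℕ, ∀ i, d i ≤ N) :
    (∃ β : ℝ, 1 < β ∧
        ∀ i : ℕ, (d i : ℤ) =
          ⌊-β * (negBetaT β)^[i] (-β / (β + 1)) + β / (β + 1)⌋) ↔
      ((∀ n : ℕ, altLe d (shiftSeq d n) ∧ altLt (shiftSeq d n) (dstarShift d)) ∧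
        d ∉ LynSet ∧ altLt d phiInf) := by
  constructor
  · rintro ⟨β, hβ, h⟩
    have hd : d = NB.dig β := by
      funext i
      have h1 := h i
      rw [NB.link_dig hβ] at h1
      exact_mod_cast h1
    rw [hd]
    refine ⟨fun n => ⟨NB.dig_lyndon hβ n, NB.upper hβ n⟩, ?_, NB.dig_lt_phi hβ⟩
    rintro ⟨_, a, ha, hlast, _, _, hne, hcond⟩
    rw [NB.lyn_cond ha] at hcond
    refine NB.not_lyn hβ ha ?_ ?_ hne hcond.1 hcond.2.1 hcond.2.2
    · rw [NB.ps_getD (by omega)]; omega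
    · funext i; exact NB.ps_per a i
  · rintro ⟨ha, hb, hc⟩
    obtain ⟨β, hβ, hd⟩ := NB.backward (fun k => (ha k).1) hb hc
    refine ⟨β, hβ, fun i => ?_⟩
    rw [NB.link_dig hβ, hd]
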